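/- (GL_n × GL_p duality, equation (3.12).) The polynomial algebra P(ℂ^n ⊗ ℂ^p), i.e. polynomials on n×p complex matrices, decomposes under the commuting actions of GL_n(ℂ) and GL_p(ℂ) (by left and right matrix multiplication) multiplicity-freely as P(ℂ^n ⊗ ℂ^p) = ⊕_λ F^λ_(n) ⊗ F^λ_(p), where λ runs over all non-negative integer partitions with ℓ(λ) ≤ min(n, p). -/

import Mathlib

open scoped BigOperators TensorProduct
open Matrix

noncomputable section

def IsPartition (f : ℕ → ℕ) : Prop :=
  (∀ ⦃i j : ℕ⦄, i ≤ j → f j ≤ f i) ∧ ∃ N, f N = 0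

def Ptn : Type := {f : ℕ → ℕ // IsPartition f}

def plen (f : ℕ → ℕ) : ℕ := sInf {k | f k = 0}

def conj (f : ℕ → ℕ) : ℕ → ℕ := fun i => Set.ncard {j | i < f j}

def double (f : ℕ → ℕ) : ℕ → ℕ := fun i => 2 * f i

def InSkew (l m : ℕ → ℕ) (i j : ℕ) : Prop := m i ≤ j ∧ j < l i

def IsLRTableau (l m nu : ℕ → ℕ) (T : ℕ → ℕ → ℕ) : Prop :=
  (∀ i, m i ≤ l i) ∧
  (∀ i j, T i j ≠ 0 ↔ InSkew l m i j) ∧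
  (∀ i j k, InSkew l m i j → InSkew l m i k → j ≤ k → T i j ≤ T i k) ∧
  (∀ i k j, InSkew l m i j → InSkew l m k j → i < k → T i j < T k j) ∧
  (∀ r, Set.ncard {p : ℕ × ℕ | T p.1 p.2 = r + 1} = nu r) ∧
  (∀ i j r, Set.ncard {p : ℕ × ℕ | (p.1 < i ∨ (p.1 = i ∧ j ≤ p.2)) ∧ T p.1 p.2 = r + 2}
          ≤ Set.ncard {p : ℕ × ℕ | (p.1 < i ∨ (p.1 = i ∧ j ≤ p.2)) ∧ T p.1 p.2 = r + 1})

def lrCoeff (l m nu : ℕ → ℕ) : ℕ := Set.ncard {T : ℕ → ℕ → ℕ | IsLRTableau l m nu T}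

section Reps

variable {G : Type*} [Group G] {V W : Type*}
  [AddCommGroup V] [Module ℂ V] [AddCommGroup W] [Module ℂ W]

def IsSubrep (ρ : Representation ℂ G V) (U : Submodule ℂ V) : Prop :=
  ∀ g : G, ∀ x ∈ U, ρ g x ∈ U

def IsIrreducibleRep (ρ : Representation ℂ G V) : Prop :=
  Nontrivial V ∧ ∀ U : Submodule ℂ V, IsSubrep ρ U → U = ⊥ ∨ U = ⊤

def equivariantMaps (π : Representation ℂ G W) (ρ : Representation ℂ G V) :
    Submodule ℂ (W →ₗ[ℂ] V) where
  carrier := {f | ∀ g : G, f ∘ₗ (π g) = (ρ g) ∘ₗ f}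
  add_mem' := by
    intro f h hf hh g
    simp only [Set.mem_setOf_eq] at *
    rw [LinearMap.add_comp, LinearMap.comp_add, hf g, hh g]
  zero_mem' := by
    intro g
    simp only [Set.mem_setOf_eq, LinearMap.zero_comp, LinearMap.comp_zero]
  smul_mem' := by
    intro c f hf g
    simp only [Set.mem_setOf_eq] at *
    rw [LinearMap.smul_comp, LinearMap.comp_smul, hf g]

def repMult (ρ : Representation ℂ G V) (π : Representation ℂ G W) : ℕ :=
  Module.finrank ℂ (equivariantMaps π ρ)

end Reps

def IsUpperUni {N : ℕ} (A : Matrix (Fin N) (Fin N) ℂ) : Prop :=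
  (∀ i, A i i = 1) ∧ ∀ i j : Fin N, (j : ℕ) < (i : ℕ) → A i j = 0

def IsGLHW (n : ℕ) (a : Fin n → ℤ) {V : Type*} [AddCommGroup V] [Module ℂ V]
    (ρ : Representation ℂ (GL (Fin n) ℂ) V) : Prop :=
  IsIrreducibleRep ρ ∧ FiniteDimensional ℂ V ∧
  ∃ v : V, v ≠ 0 ∧
    (∀ g : GL (Fin n) ℂ, IsUpperUni (g : Matrix (Fin n) (Fin n) ℂ) → ρ g v = v) ∧
    (∀ (g : GL (Fin n) ℂ) (d : Fin n → ℂ),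
      (g : Matrix (Fin n) (Fin n) ℂ) = Matrix.diagonal d →
      ρ g v = (∏ i, d i ^ (a i)) • v)

def polyWeight (n : ℕ) (lam : ℕ → ℕ) : Fin n → ℤ := fun i => (lam (i : ℕ) : ℤ)

def ratWeight (n : ℕ) (lp lm : ℕ → ℕ) : Fin n → ℤ :=
  fun i => (lp (i : ℕ) : ℤ) - (lm (n - 1 - (i : ℕ)) : ℤ)

def formGroup {ι : Type*} [Fintype ι] [DecidableEq ι] (S : Matrix ι ι ℂ) :
    Subgroup (GL ι ℂ) where
  carrier := {g | (g : Matrix ι ι ℂ)ᵀ * S * (g : Matrix ι ι ℂ) = S}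
  one_mem' := by
    simp [Matrix.transpose_one]
  mul_mem' := by
    intro a b ha hb
    set A : Matrix ι ι ℂ := (a : Matrix ι ι ℂ) with hA
    set B : Matrix ι ι ℂ := (b : Matrix ι ι ℂ) with hB
    have ha' : Aᵀ * S * A = S := ha
    have hb' : Bᵀ * S * B = S := hb
    show ((↑(a * b) : Matrix ι ι ℂ))ᵀ * S * (↑(a * b) : Matrix ι ι ℂ) = S
    have hab : (↑(a * b) : Matrix ι ι ℂ) = A * B := Units.val_mul a b
    rw [hab, Matrix.transpose_mul]
    calc Bᵀ * Aᵀ * S * (A * B) = Bᵀ * (Aᵀ * S * A) * B := by noncomm_ring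
    _ = S := by rw [ha', hb']
  inv_mem' := by
    intro a ha
    set A : Matrix ι ι ℂ := (a : Matrix ι ι ℂ) with hA
    have ha' : Aᵀ * S * A = S := ha
    set C : Matrix ι ι ℂ := ((a⁻¹ : GL ι ℂ) : Matrix ι ι ℂ) with hC
    show Cᵀ * S * C = S
    have hac : A * C = 1 := by
      rw [hA, hC, ← Units.val_mul, mul_inv_cancel, Units.val_one]
    calc Cᵀ * S * C = Cᵀ * (Aᵀ * S * A) * C := by rw [ha']
    _ = (A * C)ᵀ * S * (A * C) := by rw [Matrix.transpose_mul]; noncomm_ring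
    _ = S := by rw [hac]; simp [Matrix.transpose_one]

def symForm (n : ℕ) : Matrix (Fin n) (Fin n) ℂ :=
  Matrix.of fun i j => if (i : ℕ) + (j : ℕ) = n - 1 then 1 else 0

def sympForm (n : ℕ) : Matrix (Fin (2 * n)) (Fin (2 * n)) ℂ :=
  Matrix.of fun i j =>
    if (i : ℕ) + (j : ℕ) = 2 * n - 1 then (if (i : ℕ) < n then 1 else -1) else 0

def OGL (n : ℕ) : Subgroup (GL (Fin n) ℂ) := formGroup (symForm n)

def SpGL (n : ℕ) : Subgroup (GL (Fin (2 * n)) ℂ) := formGroup (sympForm n)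

/-- The matrix of a distinguished reflection (an element of `O_n(ℂ)` of determinant `-1`
fixing the highest weight vectors of the representations `E^mu_(n)` for
`ℓ(mu) < n/2`): for odd `n`, the reflection negating the middle basis vector; for even
`n`, the permutation swapping the two middle basis vectors. -/
def reflMatrix (n : ℕ) : Matrix (Fin n) (Fin n) ℂ :=
  Matrix.of fun i j =>
    if 2 * (i : ℕ) + 1 = n ∧ i = j then -1
    else if (2 * (i : ℕ) = n ∧ 2 * (j : ℕ) + 2 = n) ∨ (2 * (i : ℕ) + 2 = n ∧ 2 * (j : ℕ) = n)
      then 1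
    else if i = j ∧ ¬(2 * (i : ℕ) = n ∨ 2 * (i : ℕ) + 2 = n) then 1
    else 0

/-- The partition associated to `mu` (with `(mu')_1 + (mu')_2 ≤ n`): the first column
length `(mu')_1` is replaced by `n - (mu')_1`.  One has `E^{assoc n mu} = E^mu ⊗ det`. -/
def assocPtn (n : ℕ) (mu : ℕ → ℕ) : ℕ → ℕ :=
  conj (fun j => if j = 0 then n - conj mu 0 else conj mu j)

/-- `v` is a highest weight vector of weight `mu` for (the identity component of)
`O_n(ℂ)`: it is fixed by all upper triangular unipotent elements, and the diagonal
torus elements of determinant one act via the character attached to `mu`. -/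
def IsOHWvec (n : ℕ) (mu : ℕ → ℕ) {V : Type*} [AddCommGroup V] [Module ℂ V]
    (ρ : Representation ℂ (OGL n) V) (v : V) : Prop :=
  (∀ g : OGL n, IsUpperUni ((g : GL (Fin n) ℂ) : Matrix (Fin n) (Fin n) ℂ) → ρ g v = v) ∧
  (∀ (g : OGL n) (d : Fin n → ℂ),
    ((g : GL (Fin n) ℂ) : Matrix (Fin n) (Fin n) ℂ) = Matrix.diagonal d →
    (∏ i, d i) = 1 →
    ρ g v = (∏ i, d i ^ (mu (i : ℕ))) • v)

/-- `ρ` is the irreducible rational representation `E^mu_(n)` of the complex orthogonal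
group `O_n(ℂ)`, indexed by a partition `mu` with `(mu')_1 + (mu')_2 ≤ n`. -/
def IsOIrrep (n : ℕ) (mu : ℕ → ℕ) {V : Type*} [AddCommGroup V] [Module ℂ V]
    (ρ : Representation ℂ (OGL n) V) : Prop :=
  IsIrreducibleRep ρ ∧ FiniteDimensional ℂ V ∧
  (if 2 * conj mu 0 ≤ n then
    ∃ v : V, v ≠ 0 ∧ IsOHWvec n mu ρ v ∧
      (2 * conj mu 0 = n ∨
        ∀ g : OGL n, ((g : GL (Fin n) ℂ) : Matrix (Fin n) (Fin n) ℂ) = reflMatrix n →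
          ρ g v = v)
  else
    ∃ v : V, v ≠ 0 ∧ IsOHWvec n (assocPtn n mu) ρ v ∧
      (∀ g : OGL n, ((g : GL (Fin n) ℂ) : Matrix (Fin n) (Fin n) ℂ) = reflMatrix n →
        ρ g v = - v))

/-- `ρ` is the irreducible rational representation `V^mu_(2n)` of `Sp_{2n}(ℂ)` with
highest weight `mu` (a partition with at most `n` parts). -/
def IsSpHW (n : ℕ) (mu : ℕ → ℕ) {V : Type*} [AddCommGroup V] [Module ℂ V]
    (ρ : Representation ℂ (SpGL n) V) : Prop :=
  IsIrreducibleRep ρ ∧ FiniteDimensional ℂ V ∧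
  ∃ v : V, v ≠ 0 ∧
    (∀ g : SpGL n,
      IsUpperUni ((g : GL (Fin (2 * n)) ℂ) : Matrix (Fin (2 * n)) (Fin (2 * n)) ℂ) →
      ρ g v = v) ∧
    (∀ (g : SpGL n) (d : Fin (2 * n) → ℂ),
      ((g : GL (Fin (2 * n)) ℂ) : Matrix (Fin (2 * n)) (Fin (2 * n)) ℂ) = Matrix.diagonal d →
      ρ g v = (∏ i, d i ^ (mu (i : ℕ))) • v)


open scoped DirectSum

/-- The type of partitions with at most `c` parts. -/
def PtnLe (c : ℕ) : Type := {f : ℕ → ℕ // IsPartition f ∧ plen f ≤ c}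

section LeadingMinors

variable {R S : Type*} [CommRing R] [CommRing S] {n p k : ℕ}

/-- The upper left `k × k` block of an `n × p` matrix. -/
def leadBlock (A : Matrix (Fin n) (Fin p) R) (hk : k ≤ min n p) : Matrix (Fin k) (Fin k) R :=
  A.submatrix (Fin.castLE (hk.trans (min_le_left n p))) (Fin.castLE (hk.trans (min_le_right n p)))

/-- The leading principal minor of order `k` of an `n × p` matrix. -/
def leadMinor (A : Matrix (Fin n) (Fin p) R) (hk : k ≤ min n p) : R := (leadBlock A hk).det

theorem leadMinor_transpose (A : Matrix (Fin n) (Fin p) R) (hk : k ≤ min n p)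
    (hk' : k ≤ min p n) : leadMinor Aᵀ hk' = leadMinor A hk := by
  rw [leadMinor, leadMinor, ← det_transpose]
  rfl

theorem leadMinor_map (f : R →+* S) (A : Matrix (Fin n) (Fin p) R) (hk : k ≤ min n p) :
    leadMinor (A.map f) hk = f (leadMinor A hk) := by
  rw [leadMinor, leadMinor, RingHom.map_det]
  rfl

theorem leadMinor_mul_upper (X : Matrix (Fin n) (Fin p) R) (U : Matrix (Fin p) (Fin p) R)
    (hU : U.IsUpperTriangular) (hk : k ≤ min n p) :
    leadMinor (X * U) hk = leadMinor X hk *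
      ∏ i : Fin k, U (Fin.castLE (hk.trans (min_le_right n p)) i)
        (Fin.castLE (hk.trans (min_le_right n p)) i) := by
  have hkp : k ≤ p := hk.trans (min_le_right n p)
  have hblock : leadBlock (X * U) hk = leadBlock X hk * U.submatrix (Fin.castLE hkp)
      (Fin.castLE hkp) := by
    ext i j
    simp only [leadBlock, submatrix_apply, mul_apply]
    symm
    refine Fintype.sum_of_injective (Fin.castLE hkp) (Fin.castLE_injective hkp) _ _ ?_ ?_
    · intro l hl
      rw [hU, mul_zero]
      show (Fin.castLE hkp j) < l
      by_contra h
      exact hl ⟨⟨l, by have := Fin.le_def.1 (not_lt.1 h); simp at this; omega⟩, rfl⟩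
    · intro l
      rfl
  rw [leadMinor, hblock, det_mul, leadMinor]
  congr 1
  refine det_of_isUpperTriangular (M := U.submatrix (Fin.castLE hkp) (Fin.castLE hkp)) ?_
  intro i j hij
  exact hU (Fin.castLE_lt_castLE_iff hkp |>.2 hij)

theorem leadMinor_upper_transpose_mul (W : Matrix (Fin n) (Fin n) R)
    (X : Matrix (Fin n) (Fin p) R) (hW : W.IsUpperTriangular) (hk : k ≤ min n p) :
    leadMinor (Wᵀ * X) hk = (∏ i : Fin k, W (Fin.castLE (hk.trans (min_le_left n p)) i)
        (Fin.castLE (hk.trans (min_le_left n p)) i)) * leadMinor X hk := by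
  have hk' : k ≤ min p n := by rwa [min_comm]
  rw [← leadMinor_transpose _ hk hk', transpose_mul, transpose_transpose,
    leadMinor_mul_upper _ _ hW, leadMinor_transpose _ hk hk', mul_comm]

theorem leadMinor_eq_prod_of_diag (J : Matrix (Fin n) (Fin p) R)
    (hJ : ∀ (i : Fin n) (j : Fin p), (i : ℕ) ≠ j → J i j = 0) (hk : k ≤ min n p) :
    leadMinor J hk = ∏ i : Fin k, J (Fin.castLE (hk.trans (min_le_left n p)) i)
      (Fin.castLE (hk.trans (min_le_right n p)) i) := by
  refine det_of_isUpperTriangular (M := leadBlock J hk) ?_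
  intro i j hij
  exact hJ _ _ (by simpa using (Fin.val_ne_of_ne hij.ne'))

end LeadingMinors

theorem IsUpperUni.isUpperTriangular {N : ℕ} {A : Matrix (Fin N) (Fin N) ℂ} (hA : IsUpperUni A) :
    A.IsUpperTriangular := fun i j hij => hA.2 i j hij

theorem IsUpperUni.det {N : ℕ} {A : Matrix (Fin N) (Fin N) ℂ} (hA : IsUpperUni A) :
    A.det = 1 := by
  rw [det_of_isUpperTriangular hA.isUpperTriangular]
  exact Finset.prod_eq_one fun i _ => hA.1 i

section Elimination

variable {n p : ℕ}

theorem exists_isUpperUni_mul_lower (X : Matrix (Fin n) (Fin p) ℂ)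
    (hX : ∀ k (hk : k ≤ min n p), leadMinor X hk ≠ 0) :
    ∃ u : Matrix (Fin p) (Fin p) ℂ, IsUpperUni u ∧
      ∀ (i : Fin n) (j : Fin p), (i : ℕ) < j → (X * u) i j = 0 := by
  have key : ∀ j : Fin p, ∃ c : Fin p → ℂ, c j = 1 ∧ (∀ l, j < l → c l = 0) ∧
      ∀ i : Fin n, (i : ℕ) < j → ∑ l, X i l * c l = 0 := by
    intro j
    set k := min (j : ℕ) (min n p) with hkdef
    have hk : k ≤ min n p := min_le_right _ _
    have hkp : k ≤ p := hk.trans (min_le_right n p)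
    have hkj : k ≤ j := min_le_left _ _
    set b : Fin k → ℂ := fun i => X (Fin.castLE (hk.trans (min_le_left n p)) i) j
    set c := (leadBlock X hk)⁻¹ *ᵥ b
    have hc : leadBlock X hk *ᵥ c = b := by
      rw [mulVec_mulVec, mul_nonsing_inv _ (Ne.isUnit (hX k hk)), one_mulVec]
    set f : Fin p → ℂ := fun l => if h : (l : ℕ) < k then -c ⟨l, h⟩ else 0
    refine ⟨fun l => (Pi.single j 1 : Fin p → ℂ) l + f l, ?_, ?_, ?_⟩
    · simp [f, hkj]
    · intro l hl
      have : ¬ (l : ℕ) < k := by have := Fin.lt_def.1 hl; omega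
      simp [f, this, hl.ne']
    · intro i hi
      have hik : (i : ℕ) < k := by
        have := i.2; have := j.2; omega
      have h1 : ∑ l, X i l * f l = -X i j := by
        rw [← Fintype.sum_of_injective (Fin.castLE hkp) (Fin.castLE_injective hkp)
          (fun l : Fin k => X i (Fin.castLE hkp l) * (-c l))]
        · have := congrFun hc ⟨i, hik⟩
          simp only [mulVec, dotProduct, leadBlock, submatrix_apply, b] at this
          simp only [mul_neg, Finset.sum_neg_distrib]
          exact congrArg _ this
        · intro l hl
          have : ¬ (l : ℕ) < k := fun h => hl ⟨⟨l, h⟩, rfl⟩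
          simp [f, this]
        · intro l
          simp [f]
      simp [mul_add, Finset.sum_add_distrib, h1, Pi.single_apply]
  choose c h1 h2 h3 using key
  refine ⟨of fun l j => c j l, ⟨fun i => h1 i, fun i j hij => h2 j i hij⟩, fun i j hij => ?_⟩
  simpa [mul_apply] using h3 j i hij

/-- A matrix with nonvanishing leading minors is diagonalized by unipotent row and column
operations. -/
theorem exists_isUpperUni_diag (X : Matrix (Fin n) (Fin p) ℂ)
    (hX : ∀ k (hk : k ≤ min n p), leadMinor X hk ≠ 0) :
    ∃ (w : Matrix (Fin n) (Fin n) ℂ) (u : Matrix (Fin p) (Fin p) ℂ), IsUpperUni w ∧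
      IsUpperUni u ∧ ∀ (i : Fin n) (j : Fin p), (i : ℕ) ≠ j → (wᵀ * X * u) i j = 0 := by
  obtain ⟨u, hu, hXu⟩ := exists_isUpperUni_mul_lower X hX
  obtain ⟨w, hw, hwX⟩ := exists_isUpperUni_mul_lower (X * u)ᵀ (fun k hk => by
    rw [leadMinor_transpose _ (by rwa [min_comm]), leadMinor_mul_upper _ _ hu.isUpperTriangular]
    simpa [hu.1] using hX k _)
  refine ⟨w, u, hw, hu, fun i j hij => ?_⟩
  rw [Matrix.mul_assoc]
  rcases lt_or_gt_of_ne hij with h | h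
  · rw [mul_apply]
    refine Finset.sum_eq_zero fun l _ => ?_
    by_cases hl : i < l
    · rw [transpose_apply, hw.2 _ _ hl, zero_mul]
    · rw [hXu l j (lt_of_le_of_lt (Fin.le_def.1 (not_lt.1 hl)) h), mul_zero]
  · rw [← transpose_apply (wᵀ * (X * u)), transpose_mul, transpose_transpose]
    exact hwX j i h

theorem leadMinor_isUpperUni_mul_mul (X : Matrix (Fin n) (Fin p) ℂ)
    {w : Matrix (Fin n) (Fin n) ℂ} {u : Matrix (Fin p) (Fin p) ℂ} (hw : IsUpperUni w)
    (hu : IsUpperUni u) {k : ℕ} (hk : k ≤ min n p) :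
    leadMinor (wᵀ * X * u) hk = leadMinor X hk := by
  rw [leadMinor_mul_upper _ _ hu.isUpperTriangular,
    leadMinor_upper_transpose_mul _ _ hw.isUpperTriangular]
  simp [hw.1, hu.1]

/-- Two rectangular diagonal matrices with the same nonzero leading minors agree. -/
theorem eq_of_leadMinor_eq_of_diag (J K : Matrix (Fin n) (Fin p) ℂ)
    (hJ : ∀ (i : Fin n) (j : Fin p), (i : ℕ) ≠ j → J i j = 0)
    (hK : ∀ (i : Fin n) (j : Fin p), (i : ℕ) ≠ j → K i j = 0)
    (h0 : ∀ k (hk : k ≤ min n p), leadMinor J hk ≠ 0)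
    (h : ∀ k (hk : k ≤ min n p), leadMinor J hk = leadMinor K hk) : J = K := by
  ext i j
  by_cases hij : (i : ℕ) = j
  · have hk : (i : ℕ) + 1 ≤ min n p := by have := i.2; have := j.2; omega
    have hk' : (i : ℕ) ≤ min n p := by omega
    have h1 := h _ hk
    have h2 := h _ hk'
    have h3 := h0 _ hk'
    rw [leadMinor_eq_prod_of_diag _ hJ, leadMinor_eq_prod_of_diag _ hK] at h1 h2
    rw [leadMinor_eq_prod_of_diag _ hJ] at h3
    rw [Fin.prod_univ_castSucc, Fin.prod_univ_castSucc] at h1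
    simp only [Fin.castLE_castSucc] at h1
    rw [← h2] at h1
    have h4 := mul_left_cancel₀ h3 h1
    have hj : Fin.castLE (hk.trans (min_le_right n p)) (Fin.last (i : ℕ)) = j := Fin.ext hij
    have hi : Fin.castLE (hk.trans (min_le_left n p)) (Fin.last (i : ℕ)) = i := Fin.ext rfl
    rwa [hi, hj] at h4
  · rw [hJ i j hij, hK i j hij]

end Elimination

section GeneralLinear

variable {n : ℕ}

/-- The transpose of an invertible matrix. -/
def glTranspose (g : GL (Fin n) ℂ) : GL (Fin n) ℂ where
  val := (g : Matrix (Fin n) (Fin n) ℂ)ᵀ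
  inv := (↑g⁻¹ : Matrix (Fin n) (Fin n) ℂ)ᵀ
  val_inv := by rw [← transpose_mul, Units.inv_mul, transpose_one]
  inv_val := by rw [← transpose_mul, Units.mul_inv, transpose_one]

@[simp]
theorem coe_glTranspose (g : GL (Fin n) ℂ) :
    (glTranspose g : Matrix (Fin n) (Fin n) ℂ) = (g : Matrix (Fin n) (Fin n) ℂ)ᵀ := rfl

@[simp]
theorem glTranspose_glTranspose (g : GL (Fin n) ℂ) : glTranspose (glTranspose g) = g :=
  Units.ext (transpose_transpose _)

theorem glTranspose_mul (g h : GL (Fin n) ℂ) :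
    glTranspose (g * h) = glTranspose h * glTranspose g :=
  Units.ext (by simp)

@[simp]
theorem glTranspose_one : glTranspose (1 : GL (Fin n) ℂ) = 1 := Units.ext (by simp)

/-- The invertible matrix attached to a transvection. -/
def transvectionGL (t : TransvectionStruct (Fin n) ℂ) : GL (Fin n) ℂ :=
  ⟨t.toMatrix, t.inv.toMatrix, t.mul_inv, t.inv_mul⟩

theorem coe_transvectionGL (t : TransvectionStruct (Fin n) ℂ) :
    (transvectionGL t : Matrix (Fin n) (Fin n) ℂ) = transvection t.i t.j t.c := rfl

theorem coe_transvectionGL_pow (t : TransvectionStruct (Fin n) ℂ) (k : ℕ) :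
    (↑(transvectionGL t ^ k) : Matrix (Fin n) (Fin n) ℂ) = transvection t.i t.j (k * t.c) := by
  induction k with
  | zero => simp
  | succ k ih =>
    rw [pow_succ, Units.val_mul, ih, coe_transvectionGL,
      transvection_mul_transvection_same _ _ t.hij]
    push_cast
    ring_nf

theorem exists_conj_transvectionGL_pow (t : TransvectionStruct (Fin n) ℂ) {k : ℕ} (hk : 0 < k) :
    ∃ d : GL (Fin n) ℂ, transvectionGL t ^ k = d * transvectionGL t * d⁻¹ := by
  have hk0 : (k : ℂ) ≠ 0 := by exact_mod_cast hk.ne'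
  set v : Fin n → ℂ := fun l => if l = t.i then (k : ℂ) else 1
  have hv : (diagonal v).det ≠ 0 := by
    rw [det_diagonal]
    refine Finset.prod_ne_zero_iff.2 fun l _ => ?_
    simp only [v]
    split_ifs <;> simp [hk0]
  refine ⟨GeneralLinearGroup.mkOfDetNeZero _ hv, ?_⟩
  rw [eq_mul_inv_iff_mul_eq]
  refine Units.ext ?_
  rw [Units.val_mul, Units.val_mul, coe_transvectionGL_pow, coe_transvectionGL]
  show transvection t.i t.j (k * t.c) * diagonal v = diagonal v * transvection t.i t.j t.c
  have hij := t.hij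
  ext a b
  simp only [transvection, mul_diagonal, diagonal_mul, Matrix.add_apply, one_apply, single_apply, v]
  split_ifs <;> grind

/-- `g` can be diagonalized by unipotent row and column operations. -/
def InBigCell (g : GL (Fin n) ℂ) : Prop :=
  ∃ w u d : GL (Fin n) ℂ, IsUpperUni (w : Matrix (Fin n) (Fin n) ℂ) ∧
    IsUpperUni (u : Matrix (Fin n) (Fin n) ℂ) ∧ glTranspose w * g * u = d ∧
    ∃ v : Fin n → ℂ, (d : Matrix (Fin n) (Fin n) ℂ) = diagonal v

theorem inBigCell_of_leadMinor_ne_zero (g : GL (Fin n) ℂ)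
    (hg : ∀ k (hk : k ≤ min n n), leadMinor (g : Matrix (Fin n) (Fin n) ℂ) hk ≠ 0) :
    InBigCell g := by
  obtain ⟨w, u, hw, hu, hd⟩ := exists_isUpperUni_diag _ hg
  set w' := GeneralLinearGroup.mkOfDetNeZero w (by simp [hw.det])
  set u' := GeneralLinearGroup.mkOfDetNeZero u (by simp [hu.det])
  refine ⟨w', u', glTranspose w' * g * u', hw, hu, rfl, fun i => (wᵀ * g * u) i i, ?_⟩
  ext i j
  rw [diagonal_apply]
  split_ifs with h
  · rw [← h]; rfl
  · exact hd i j (Fin.val_ne_of_ne h)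

/-- A curve in `GL_n` with polynomial entries, joining `d` to the product of all factors. -/
def transvectionPath (L L' : List (TransvectionStruct (Fin n) ℂ)) (d : GL (Fin n) ℂ) (k : ℕ) :
    GL (Fin n) ℂ :=
  (L.map fun t => transvectionGL t ^ k).prod * d * (L'.map fun t => transvectionGL t ^ k).prod

theorem exists_transvectionPath_one (g : GL (Fin n) ℂ) :
    ∃ (L L' : List (TransvectionStruct (Fin n) ℂ)) (d : GL (Fin n) ℂ),
      (∃ v : Fin n → ℂ, (d : Matrix (Fin n) (Fin n) ℂ) = diagonal v) ∧
      g = transvectionPath L L' d 1 := by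
  obtain ⟨L, L', v, h⟩ := Pivot.exists_list_transvec_mul_diagonal_mul_list_transvec
    (g : Matrix (Fin n) (Fin n) ℂ)
  have hv : (diagonal v).det ≠ 0 := by
    intro h0
    have := congrArg Matrix.det h
    rw [det_mul, det_mul, h0] at this
    exact (g.isUnit.map detMonoidHom).ne_zero (by simpa using this)
  refine ⟨L, L', GeneralLinearGroup.mkOfDetNeZero _ hv, ⟨v, rfl⟩, Units.ext ?_⟩
  have hL : ∀ L : List (TransvectionStruct (Fin n) ℂ),
      (↑(L.map fun t => transvectionGL t ^ 1).prod : Matrix (Fin n) (Fin n) ℂ) =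
        (L.map TransvectionStruct.toMatrix).prod := by
    intro L
    induction L with
    | nil => simp
    | cons t L ih =>
      rw [List.map_cons, List.prod_cons, Units.val_mul, ih, pow_one, List.map_cons,
        List.prod_cons]
      rfl
  rw [transvectionPath, Units.val_mul, Units.val_mul, hL, hL, h]
  rfl

open Polynomial in
theorem exists_matrix_eval_eq_transvectionPath (L L' : List (TransvectionStruct (Fin n) ℂ))
    (d : GL (Fin n) ℂ) : ∃ M : Matrix (Fin n) (Fin n) ℂ[X], ∀ k : ℕ,
      M.map (evalRingHom (k : ℂ)) = (transvectionPath L L' d k : Matrix (Fin n) (Fin n) ℂ) := by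
  have hL : ∀ L : List (TransvectionStruct (Fin n) ℂ), ∃ M : Matrix (Fin n) (Fin n) ℂ[X],
      ∀ k : ℕ, M.map (evalRingHom (k : ℂ)) =
        (↑(L.map fun t => transvectionGL t ^ k).prod : Matrix (Fin n) (Fin n) ℂ) := by
    intro L
    induction L with
    | nil => exact ⟨1, fun k => by simp⟩
    | cons t L ih =>
      obtain ⟨M, hM⟩ := ih
      refine ⟨transvection t.i t.j (X * C t.c) * M, fun k => ?_⟩
      rw [Matrix.map_mul, hM, List.map_cons, List.prod_cons, Units.val_mul,
        coe_transvectionGL_pow]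
      congr 1
      ext a b
      simp only [transvection, map_apply, Matrix.add_apply, one_apply, single_apply]
      split_ifs <;> simp <;> ring
  obtain ⟨M, hM⟩ := hL L
  obtain ⟨M', hM'⟩ := hL L'
  refine ⟨M * (d : Matrix (Fin n) (Fin n) ℂ).map C * M', fun k => ?_⟩
  rw [Matrix.map_mul, Matrix.map_mul, hM, hM', transvectionPath, Units.val_mul, Units.val_mul]
  congr 2
  ext a b
  simp

/-- Functions on `GL_n` that are polynomial along the curves `transvectionPath`. -/
def IsPathPolynomial (φ : GL (Fin n) ℂ → ℂ) : Prop :=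
  ∀ L L' d, ∃ P : Polynomial ℂ, ∀ k : ℕ, φ (transvectionPath L L' d k) = P.eval (k : ℂ)

theorem IsPathPolynomial.eq_of_eq_on_bigCell {φ ψ : GL (Fin n) ℂ → ℂ} (hφ : IsPathPolynomial φ)
    (hψ : IsPathPolynomial ψ) (h : ∀ g, InBigCell g → φ g = ψ g) (g : GL (Fin n) ℂ) :
    φ g = ψ g := by
  obtain ⟨L, L', d, ⟨v, hv⟩, rfl⟩ := exists_transvectionPath_one g
  obtain ⟨P, hP⟩ := hφ L L' d
  obtain ⟨Q, hQ⟩ := hψ L L' d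
  obtain ⟨M, hM⟩ := exists_matrix_eval_eq_transvectionPath L L' d
  have hmin : ∀ (k : ℕ) (hk : k ≤ min n n) (l : ℕ), (leadMinor M hk).eval (l : ℂ) =
      leadMinor (transvectionPath L L' d l : Matrix (Fin n) (Fin n) ℂ) hk := by
    intro k hk l
    rw [← hM, leadMinor_map]
    rfl
  set D : Polynomial ℂ := ∏ k : Fin (n + 1), leadMinor M (k := k) (by have := k.2; omega)
  have hD0 : D ≠ 0 := by
    refine Finset.prod_ne_zero_iff.2 fun k _ h0 => ?_
    have h1 := hmin k (by have := k.2; omega) 0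
    rw [h0] at h1
    have hp0 : transvectionPath L L' d 0 = d := by simp [transvectionPath]
    rw [hp0, hv, leadMinor_eq_prod_of_diag _
      (fun i j hij => diagonal_apply_ne _ (fun e => hij (congrArg _ e)))] at h1
    have hdet : (diagonal v).det ≠ 0 := by
      rw [← hv]
      exact (d.isUnit.map detMonoidHom).ne_zero
    rw [det_diagonal, Finset.prod_ne_zero_iff] at hdet
    have h2 := Finset.prod_eq_zero_iff.1 (h1.symm.trans (by simp))
    obtain ⟨i, -, hi⟩ := h2
    rw [diagonal_apply] at hi
    exact hdet _ (Finset.mem_univ _) (by simpa using hi)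
  have hzero : D * (P - Q) = 0 := by
    refine Polynomial.eq_zero_of_infinite_isRoot _ (Set.Infinite.mono ?_
      (Set.infinite_range_of_injective (Nat.cast_injective (R := ℂ))))
    rintro _ ⟨l, rfl⟩
    show Polynomial.eval (l : ℂ) (D * (P - Q)) = 0
    rw [Polynomial.eval_mul]
    by_cases hDl : D.eval (l : ℂ) = 0
    · rw [hDl, zero_mul]
    · rw [Polynomial.eval_prod, ← ne_eq, Finset.prod_ne_zero_iff] at hDl
      rw [Polynomial.eval_sub, ← hP, ← hQ, h _ (inBigCell_of_leadMinor_ne_zero _ ?_), sub_self,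
        mul_zero]
      intro k hk
      rw [← hmin]
      exact hDl ⟨k, by omega⟩ (Finset.mem_univ _)
  have hPQ : P = Q := sub_eq_zero.1 ((mul_eq_zero.1 hzero).resolve_left hD0)
  rw [hP, hQ, hPQ]

end GeneralLinear

section Unipotent

variable {V : Type*} [AddCommGroup V] [Module ℂ V] {n : ℕ}

/-- An invertible operator conjugate to all its positive powers is unipotent. -/
theorem isNilpotent_sub_one_of_conj_pow [FiniteDimensional ℂ V] (u : (Module.End ℂ V)ˣ)
    (h : ∀ k : ℕ, 0 < k → ∃ s : (Module.End ℂ V)ˣ, u ^ k = s * u * s⁻¹) :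
    IsNilpotent ((u : Module.End ℂ V) - 1) := by
  set f : Module.End ℂ V := u.val
  have hpow : ∀ k : ℕ, 0 < k → (fun x => x ^ k) '' spectrum ℂ f = spectrum ℂ f := by
    intro k hk
    obtain ⟨s, hs⟩ := h k hk
    rw [← spectrum.map_pow_of_pos f hk]
    have : f ^ k = s * f * ↑s⁻¹ := by
      have := congrArg Units.val hs
      simpa using this
    rw [this, spectrum.units_conjugate]
  have hfin : (spectrum ℂ f).Finite := Module.End.finite_spectrum f
  have hne : ∀ μ ∈ spectrum ℂ f, μ ≠ 0 := by
    rintro μ hμ rfl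
    exact spectrum.zero_notMem_iff ℂ |>.2 u.isUnit hμ
  have hroot : ∀ μ ∈ spectrum ℂ f, ∃ r : ℕ, 0 < r ∧ μ ^ r = 1 := by
    intro μ hμ
    obtain ⟨a, b, hab, he⟩ := Set.Finite.exists_lt_map_eq_of_forall_mem
      (f := fun a : ℕ => μ ^ (a + 1)) (t := spectrum ℂ f)
      (fun a => by
        rw [← hpow (a + 1) a.succ_pos]
        exact ⟨μ, hμ, rfl⟩) hfin
    refine ⟨b - a, by omega, ?_⟩
    have h1 : μ ^ (b + 1) = μ ^ (a + 1) * μ ^ (b - a) := by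
      rw [← pow_add]; congr 1; omega
    have h2 : μ ^ (a + 1) ≠ 0 := pow_ne_zero _ (hne μ hμ)
    have h3 : μ ^ (a + 1) * μ ^ (b - a) = μ ^ (a + 1) * 1 := by
      rw [← h1, mul_one]; exact he.symm
    exact mul_left_cancel₀ h2 h3
  choose! r hr0 hr1 using hroot
  have hone : ∀ ν ∈ spectrum ℂ f, ν = 1 := by
    intro ν hν
    have hM : 0 < ∏ μ ∈ hfin.toFinset, r μ :=
      Finset.prod_pos fun μ hμ => hr0 μ (hfin.mem_toFinset.1 hμ)
    rw [← hpow _ hM] at hν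
    obtain ⟨μ, hμ, rfl⟩ := hν
    obtain ⟨c, hc⟩ := Finset.dvd_prod_of_mem r (hfin.mem_toFinset.2 hμ)
    simp only [hc, pow_mul, hr1 μ hμ, one_pow]
  have htop : f.maxGenEigenspace 1 = ⊤ := by
    rw [eq_top_iff, ← Module.End.iSup_maxGenEigenspace_eq_top f]
    refine iSup_le fun μ => ?_
    by_cases hμ : μ = 1
    · rw [hμ]
    · have : f.maxGenEigenspace μ = ⊥ := by
        by_contra hb
        have h1 : f.HasEigenvalue μ := Module.End.HasUnifEigenvalue.lt zero_lt_one hb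
        exact hμ (hone μ (Module.End.hasEigenvalue_iff_mem_spectrum.1 h1))
      rw [this]
      exact bot_le
  rw [Module.End.isNilpotent_iff_of_finite]
  intro m
  simpa using (Module.End.mem_maxGenEigenspace f 1 m).1 (htop ▸ Submodule.mem_top)

theorem isNilpotent_transvectionGL_sub_one [FiniteDimensional ℂ V]
    (ρ : Representation ℂ (GL (Fin n) ℂ) V) (t : TransvectionStruct (Fin n) ℂ) :
    IsNilpotent (ρ (transvectionGL t) - 1) := by
  refine isNilpotent_sub_one_of_conj_pow (ρ.asGroupHom (transvectionGL t)) fun k hk => ?_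
  obtain ⟨d, hd⟩ := exists_conj_transvectionGL_pow t hk
  exact ⟨ρ.asGroupHom d, by rw [← map_pow, hd, map_mul, map_mul, map_inv]⟩

/-- Sequences of vectors all of whose coordinates are polynomial. -/
def IsPolynomialSeq (f : ℕ → V) : Prop :=
  ∀ m : Module.Dual ℂ V, ∃ P : Polynomial ℂ, ∀ k : ℕ, m (f k) = P.eval (k : ℂ)

theorem exists_polynomial_eval_eq_choose (j : ℕ) :
    ∃ P : Polynomial ℂ, ∀ k : ℕ, (k.choose j : ℂ) = P.eval (k : ℂ) := by
  refine ⟨Polynomial.C ((j.factorial : ℂ)⁻¹) * descPochhammer ℂ j, fun k => ?_⟩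
  rw [Polynomial.eval_mul, Polynomial.eval_C, descPochhammer_eval_eq_descFactorial,
    Nat.descFactorial_eq_factorial_mul_choose]
  have : (j.factorial : ℂ) ≠ 0 := by exact_mod_cast j.factorial_ne_zero
  push_cast
  field_simp

theorem IsPolynomialSeq.pow_apply {f : ℕ → V} (hf : IsPolynomialSeq f) {u : Module.End ℂ V}
    (hu : IsNilpotent (u - 1)) : IsPolynomialSeq fun k => (u ^ k) (f k) := by
  obtain ⟨N, hN⟩ := hu
  intro m
  have hexp : ∀ k : ℕ, u ^ k = ∑ j ∈ Finset.range N, (k.choose j : ℂ) • (u - 1) ^ j := by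
    intro k
    have h1 : u ^ k = ∑ j ∈ Finset.range (k + 1), (k.choose j : ℂ) • (u - 1) ^ j := by
      conv_lhs => rw [← sub_add_cancel u 1, (Commute.one_right (u - 1)).add_pow]
      refine Finset.sum_congr rfl fun j _ => ?_
      rw [one_pow, mul_one, ← nsmul_eq_mul', Nat.cast_smul_eq_nsmul]
    rw [h1]
    have h2 : ∀ j, k + 1 ≤ j ∨ N ≤ j → (k.choose j : ℂ) • (u - 1) ^ j = 0 := by
      rintro j (hj | hj)
      · rw [Nat.choose_eq_zero_of_lt hj, Nat.cast_zero, zero_smul]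
      · rw [pow_eq_zero_of_le hj hN, smul_zero]
    rw [Finset.sum_subset (Finset.range_mono (le_max_left (k + 1) N))
        (fun j _ hj => h2 j (Or.inl (by simpa using hj))),
      Finset.sum_subset (Finset.range_mono (le_max_right (k + 1) N))
        (fun j _ hj => h2 j (Or.inr (by simpa using hj)))]
  choose P hP using exists_polynomial_eval_eq_choose
  choose Q hQ using fun j => hf (m ∘ₗ ((u - 1) ^ j))
  refine ⟨∑ j ∈ Finset.range N, P j * Q j, fun k => ?_⟩
  beta_reduce
  rw [hexp, Polynomial.eval_finsetSum, LinearMap.sum_apply, map_sum]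
  refine Finset.sum_congr rfl fun j _ => ?_
  rw [LinearMap.smul_apply, map_smul, Polynomial.eval_mul, ← hP, ← hQ]
  rfl

theorem isPathPolynomial_coeff [FiniteDimensional ℂ V] (ρ : Representation ℂ (GL (Fin n) ℂ) V)
    (l : Module.Dual ℂ V) (v : V) : IsPathPolynomial fun g => l (ρ g v) := by
  have hL : ∀ (L : List (TransvectionStruct (Fin n) ℂ)) (f : ℕ → V), IsPolynomialSeq f →
      IsPolynomialSeq fun k => ρ (L.map fun t => transvectionGL t ^ k).prod (f k) := by
    intro L
    induction L with
    | nil => intro f hf; simpa using hf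
    | cons t L ih =>
      intro f hf
      have := (ih f hf).pow_apply (isNilpotent_transvectionGL_sub_one ρ t)
      simpa [← map_pow] using this
  intro L L' d
  have h1 : IsPolynomialSeq fun k =>
      ρ d (ρ (L'.map fun t => transvectionGL t ^ k).prod v) := fun m =>
    hL L' (fun _ => v) (fun m => ⟨Polynomial.C (m v), fun k => by simp⟩) (m ∘ₗ ρ d)
  obtain ⟨P, hP⟩ := hL L _ h1 l
  refine ⟨P, fun k => ?_⟩
  rw [← hP, transvectionPath]
  beta_reduce
  rw [map_mul, map_mul]
  rfl

theorem exists_fixed_of_commute [FiniteDimensional ℂ V] (S : Set (Module.End ℂ V))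
    (hS : ∀ a ∈ S, IsNilpotent (a - 1)) (W : Submodule ℂ V) (hW : W ≠ ⊥)
    (hstab : ∀ a ∈ S, ∀ x ∈ W, a x ∈ W)
    (hcomm : ∀ a ∈ S, ∀ b ∈ S, ∀ x ∈ W, a (b x) = b (a x)) :
    ∃ w ∈ W, w ≠ 0 ∧ ∀ a ∈ S, a w = w := by
  induction hd : Module.finrank ℂ W using Nat.strong_induction_on generalizing W with
  | _ d ih =>
    by_cases hfix : ∀ a ∈ S, ∀ x ∈ W, a x = x
    · obtain ⟨w, hw, hw0⟩ := Submodule.exists_mem_ne_zero_of_ne_bot hW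
      exact ⟨w, hw, hw0, fun a ha => hfix a ha w hw⟩
    · push Not at hfix
      obtain ⟨a, ha, x, hx, hax⟩ := hfix
      set W' : Submodule ℂ V := W ⊓ LinearMap.ker (a - 1)
      have hmem : ∀ y, y ∈ W' ↔ y ∈ W ∧ a y = y := by
        intro y
        simp [W', sub_eq_zero]
      have hlt : W' < W := by
        refine lt_of_le_of_ne inf_le_left fun h => hax ?_
        exact ((hmem x).1 (h ▸ hx)).2
      have hW' : W' ≠ ⊥ := by
        obtain ⟨N, hN⟩ := hS a ha
        obtain ⟨w, hw, hw0⟩ := Submodule.exists_mem_ne_zero_of_ne_bot hW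
        have hex : ∃ k : ℕ, ((a - 1) ^ k) w = 0 := ⟨N, by rw [hN]; rfl⟩
        classical
        have hk0 : Nat.find hex ≠ 0 := by
          intro h0
          have := Nat.find_spec hex
          rw [h0] at this
          exact hw0 this
        obtain ⟨k, hk⟩ := Nat.exists_eq_succ_of_ne_zero hk0
        have hstab' : ∀ k : ℕ, ((a - 1) ^ k) w ∈ W := by
          intro k
          induction k with
          | zero => simpa using hw
          | succ k ihk =>
            rw [pow_succ', Module.End.mul_apply, LinearMap.sub_apply]
            exact W.sub_mem (hstab a ha _ ihk) ihk
        refine (Submodule.ne_bot_iff _).2 ⟨((a - 1) ^ k) w, ⟨hstab' k, ?_⟩, ?_⟩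
        · have := Nat.find_spec hex
          rw [hk, pow_succ'] at this
          exact this
        · exact Nat.find_min hex (by omega)
      obtain ⟨w, hw, hw0, hfix⟩ := ih _ (hd ▸ Submodule.finrank_lt_finrank_of_lt hlt) W' hW'
        (fun b hb y hy => (hmem _).2 ⟨hstab b hb y ((hmem y).1 hy).1, by
          rw [hcomm a ha b hb y ((hmem y).1 hy).1, ((hmem y).1 hy).2]⟩)
        (fun b hb c hc y hy => hcomm b hb c hc y ((hmem y).1 hy).1) rfl
      exact ⟨w, hlt.le hw, hw0, hfix⟩

/-- The upper unipotent group is generated by transvections. -/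
theorem IsUpperUni.mem_of_transvectionGL_mem (H : Submonoid (GL (Fin n) ℂ))
    (hH : ∀ t : TransvectionStruct (Fin n) ℂ, t.i < t.j → transvectionGL t ∈ H)
    {g : GL (Fin n) ℂ} (hg : IsUpperUni (g : Matrix (Fin n) (Fin n) ℂ)) : g ∈ H := by
  set A : Matrix (Fin n) (Fin n) ℂ := g.val
  have key : ∀ s : Finset (Fin n × Fin n), (∀ x ∈ s, x.1 < x.2) →
      ∃ h ∈ H, (h : Matrix (Fin n) (Fin n) ℂ) = 1 + ∑ x ∈ s, single x.1 x.2 (A x.1 x.2) := by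
    intro s
    induction s using Finset.induction_on_min_value (fun x : Fin n × Fin n => x.2) with
    | empty => exact fun _ => ⟨1, H.one_mem, by simp⟩
    | insert a s has hmin ih =>
      intro hs
      obtain ⟨h, hh, hhe⟩ := ih fun x hx => hs x (Finset.mem_insert_of_mem hx)
      have ha : a.1 < a.2 := hs a (Finset.mem_insert_self _ _)
      refine ⟨h * transvectionGL ⟨a.1, a.2, ha.ne, A a.1 a.2⟩, H.mul_mem hh (hH _ ha), ?_⟩
      have hz : (∑ x ∈ s, single x.1 x.2 (A x.1 x.2)) * single a.1 a.2 (A a.1 a.2) = 0 := by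
        rw [Finset.sum_mul]
        exact Finset.sum_eq_zero fun x hx =>
          single_mul_single_of_ne _ _ _ _ (ha.trans_le (hmin x hx)).ne' _
      rw [Units.val_mul, hhe, coe_transvectionGL, Finset.sum_insert has, transvection,
        mul_add, mul_one, add_mul, one_mul, hz, add_zero]
      abel
  obtain ⟨h, hh, hhe⟩ := key (Finset.univ.filter fun x : Fin n × Fin n => x.1 < x.2) (by simp)
  have : g = h := by
    refine Units.ext ?_
    rw [hhe]
    ext i j
    rw [Matrix.add_apply, Matrix.sum_apply]
    have hsum : ∑ x ∈ Finset.univ.filter (fun x : Fin n × Fin n => x.1 < x.2),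
        single x.1 x.2 (A x.1 x.2) i j = if i < j then A i j else 0 := by
      rw [Finset.sum_filter, Finset.sum_eq_single (i, j)]
      · simp
      · intro x _ hx
        split_ifs
        · refine single_apply_of_ne _ _ _ _ _ ?_
          rintro ⟨h1, h2⟩
          exact hx (Prod.ext h1 h2)
        · rfl
      · simp
    rw [hsum]
    rcases lt_trichotomy i j with h | rfl | h
    · simp [h, h.ne, A]
    · simpa using hg.1 i
    · simpa [h.not_gt, h.ne'] using hg.2 i j h
  rwa [this]

theorem transvectionGL_mul_comm_or {d : ℕ} (hd : 1 ≤ d) (t s : TransvectionStruct (Fin n) ℂ)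
    {e : ℕ} (he : 1 ≤ e) (ht : (t.i : ℕ) + d ≤ t.j) (hs : (s.i : ℕ) + e ≤ s.j) :
    transvectionGL t * transvectionGL s = transvectionGL s * transvectionGL t ∨
    ∃ c : TransvectionStruct (Fin n) ℂ, (c.i : ℕ) + (d + e) ≤ c.j ∧
      transvectionGL t * transvectionGL s =
        transvectionGL s * transvectionGL t * transvectionGL c := by
  obtain ⟨i, j, hij, a⟩ := t
  obtain ⟨k, l, hkl, b⟩ := s
  simp only at ht hs
  by_cases h1 : j = k
  · subst h1
    have hil : i ≠ l := by rintro rfl; omega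
    refine Or.inr ⟨⟨i, l, hil, a * b⟩, by simp only; omega, Units.ext ?_⟩
    simp only [Units.val_mul, coe_transvectionGL, transvection, mul_add, add_mul, mul_one, one_mul,
      single_mul_single_same, single_mul_single_of_ne _ _ _ _ hil.symm,
      single_mul_single_of_ne _ _ _ _ hij.symm, add_zero]
    abel
  · by_cases h2 : l = i
    · subst h2
      have hkj : k ≠ j := fun e => h1 e.symm
      refine Or.inr ⟨⟨k, j, hkj, -(a * b)⟩, by simp only; omega, Units.ext ?_⟩
      simp only [Units.val_mul, coe_transvectionGL, transvection, mul_add, add_mul, mul_one,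
        one_mul, single_mul_single_same, single_mul_single_of_ne _ _ _ _ h1,
        single_mul_single_of_ne _ _ _ _ hkl.symm, add_zero]
      have hneg : (single k j (-(a * b)) : Matrix (Fin n) (Fin n) ℂ) = -single k j (b * a) := by
        ext x y
        simp only [Matrix.neg_apply, single_apply, mul_comm b a]
        split_ifs <;> simp
      rw [hneg]
      abel
    · refine Or.inl (Units.ext ?_)
      simp only [Units.val_mul, coe_transvectionGL, transvection, mul_add, add_mul, mul_one,
        one_mul, single_mul_single_of_ne _ _ _ _ h1, single_mul_single_of_ne _ _ _ _ h2]
      abel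

theorem exists_isUpperUni_fixed [FiniteDimensional ℂ V] [Nontrivial V]
    (ρ : Representation ℂ (GL (Fin n) ℂ) V) :
    ∃ v : V, v ≠ 0 ∧ ∀ u : GL (Fin n) ℂ, IsUpperUni (u : Matrix (Fin n) (Fin n) ℂ) →
      ρ u v = v := by
  have key : ∀ e d : ℕ, 1 ≤ d → n ≤ d + e → ∃ v : V, v ≠ 0 ∧
      ∀ t : TransvectionStruct (Fin n) ℂ, (t.i : ℕ) + d ≤ t.j → ρ (transvectionGL t) v = v := by
    intro e
    induction e with
    | zero =>
      intro d hd hn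
      obtain ⟨v, hv⟩ := exists_ne (0 : V)
      exact ⟨v, hv, fun t ht => absurd t.j.2 (by omega)⟩
    | succ e ih =>
      intro d hd hn
      obtain ⟨v₀, hv₀, hfix₀⟩ := ih (d + 1) (by omega) (by omega)
      let W : Submodule ℂ V :=
        ⨅ t : {t : TransvectionStruct (Fin n) ℂ // (t.i : ℕ) + (d + 1) ≤ t.j},
          LinearMap.ker (ρ (transvectionGL t.1) - 1)
      have hW : ∀ w, w ∈ W ↔ ∀ t : TransvectionStruct (Fin n) ℂ, (t.i : ℕ) + (d + 1) ≤ t.j →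
          ρ (transvectionGL t) w = w := by
        intro w
        simp [W, Submodule.mem_iInf, sub_eq_zero]
      obtain ⟨w, -, hw0, hw⟩ := exists_fixed_of_commute
        {a | ∃ t : TransvectionStruct (Fin n) ℂ, (t.i : ℕ) + d ≤ t.j ∧ ρ (transvectionGL t) = a}
        (by rintro _ ⟨t, -, rfl⟩; exact isNilpotent_transvectionGL_sub_one ρ t) W
        ((Submodule.ne_bot_iff _).2 ⟨v₀, (hW _).2 hfix₀, hv₀⟩)
        (by
          rintro _ ⟨t, ht, rfl⟩ x hx
          refine (hW _).2 fun s hs => ?_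
          rw [← Module.End.mul_apply, ← map_mul]
          rcases transvectionGL_mul_comm_or (by omega) s t hd hs ht with h | ⟨c, hc, h⟩
          · rw [h, map_mul, Module.End.mul_apply, (hW x).1 hx s hs]
          · rw [h, map_mul, map_mul, Module.End.mul_apply, Module.End.mul_apply,
              (hW x).1 hx c (by omega), (hW x).1 hx s hs])
        (by
          rintro _ ⟨t, ht, rfl⟩ _ ⟨s, hs, rfl⟩ x hx
          rw [← Module.End.mul_apply, ← map_mul, ← Module.End.mul_apply, ← map_mul]
          rcases transvectionGL_mul_comm_or hd t s hd ht hs with h | ⟨c, hc, h⟩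
          · rw [h]
          · rw [h, map_mul, Module.End.mul_apply, (hW x).1 hx c (by omega)])
      exact ⟨w, hw0, fun t ht => hw _ ⟨t, ht, rfl⟩⟩
  obtain ⟨v, hv0, hv⟩ := key n 1 le_rfl (by omega)
  refine ⟨v, hv0, fun u hu => ?_⟩
  let H : Submonoid (GL (Fin n) ℂ) :=
    { carrier := {g | ρ g v = v}
      one_mem' := by simp
      mul_mem' := by
        intro a b (ha : ρ a v = v) (hb : ρ b v = v)
        show ρ (a * b) v = v
        rw [map_mul, Module.End.mul_apply, hb, ha] }
  exact hu.mem_of_transvectionGL_mem H (fun t ht => hv t ht)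

end Unipotent

section Matching

variable {G H : Type*} [Group G] [Group H] {A B : Type*} [AddCommGroup A] [Module ℂ A]
  [AddCommGroup B] [Module ℂ B]

/-- Cyclic representations with the same matrix coefficient are isomorphic. -/
theorem exists_injective_of_coeff_eq (σ : Representation ℂ G A) (τ : Representation ℂ G B)
    (a : A) (b : B) (α : Module.Dual ℂ A) (β : Module.Dual ℂ B)
    (h : ∀ g, α (σ g a) = β (τ g b))
    (hA : Submodule.span ℂ (Set.range fun g => σ g a) = ⊤)
    (hα : ∀ x, (∀ g, α (σ g x) = 0) → x = 0)
    (hβ : ∀ y ∈ Submodule.span ℂ (Set.range fun g => τ g b), (∀ g, β (τ g y) = 0) → y = 0) :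
    ∃ f : A →ₗ[ℂ] B, Function.Injective f ∧ (∀ g x, f (σ g x) = τ g (f x)) ∧
      LinearMap.range f = Submodule.span ℂ (Set.range fun g => τ g b) := by
  set S := Finsupp.linearCombination ℂ fun g => σ g a
  set T := Finsupp.linearCombination ℂ fun g => τ g b
  have hST : ∀ g c, α (σ g (S c)) = β (τ g (T c)) := by
    intro g c
    induction c using Finsupp.induction_linear with
    | zero => simp
    | add c d hc hd => simp only [map_add, hc, hd]
    | single k r =>
      simp only [S, T, Finsupp.linearCombination_single, map_smul]
      rw [← Module.End.mul_apply, ← map_mul, h, map_mul, Module.End.mul_apply]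
  have hT : LinearMap.range T = Submodule.span ℂ (Set.range fun g => τ g b) :=
    Finsupp.range_linearCombination ℂ
  have hker : ∀ c, S c = 0 ↔ T c = 0 := by
    intro c
    constructor
    · intro hc
      refine hβ _ (hT ▸ LinearMap.mem_range_self T c) fun g => ?_
      rw [← hST, hc, map_zero, map_zero]
    · intro hc
      refine hα _ fun g => ?_
      rw [hST, hc, map_zero, map_zero]
  have hS : LinearMap.range S = ⊤ := (Finsupp.range_linearCombination ℂ).trans hA
  obtain ⟨s, hs⟩ := S.exists_rightInverse_of_surjective hS
  have hs' : ∀ x, S (s x) = x := fun x => LinearMap.congr_fun hs x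
  have hfS : ∀ c, (T ∘ₗ s) (S c) = T c := by
    intro c
    rw [LinearMap.comp_apply, ← sub_eq_zero, ← map_sub, ← hker, map_sub, hs', sub_self]
  refine ⟨T ∘ₗ s, ?_, ?_, ?_⟩
  · rw [← LinearMap.ker_eq_bot, LinearMap.ker_eq_bot']
    intro x hx
    rw [← hs' x, (hker _).2 hx]
  · intro g x
    obtain ⟨c, rfl⟩ := LinearMap.range_eq_top.1 hS x
    induction c using Finsupp.induction_linear with
    | zero => simp
    | add c d hc hd => simp only [map_add, hc, hd]
    | single k r =>
      have h1 : ∀ k r, S (Finsupp.single k r) = r • σ k a :=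
        fun k r => Finsupp.linearCombination_single ℂ _ _
      have h2 : ∀ k r, T (Finsupp.single k r) = r • τ k b :=
        fun k r => Finsupp.linearCombination_single ℂ _ _
      have h3 : σ g (S (Finsupp.single k r)) = S (Finsupp.single (g * k) r) := by
        rw [h1, h1, map_smul, map_mul, Module.End.mul_apply]
      rw [h3, hfS, hfS, h2, h2, map_smul, map_mul, Module.End.mul_apply]
  · rw [← hT]
    refine le_antisymm (LinearMap.range_comp_le_range _ _) ?_
    rintro _ ⟨c, rfl⟩
    exact ⟨S c, hfS c⟩

theorem IsIrreducibleRep.span_orbit_eq_top {σ : Representation ℂ G A} (hσ : IsIrreducibleRep σ)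
    {a : A} (ha : a ≠ 0) : Submodule.span ℂ (Set.range fun g => σ g a) = ⊤ := by
  refine (hσ.2 _ ?_).resolve_left ?_
  · intro g x hx
    induction hx using Submodule.span_induction with
    | mem x hx =>
      obtain ⟨k, rfl⟩ := hx
      refine Submodule.subset_span ⟨g * k, ?_⟩
      simp
    | zero => simp
    | add x y _ _ hx hy => rw [map_add]; exact Submodule.add_mem _ hx hy
    | smul c x _ hx => rw [map_smul]; exact Submodule.smul_mem _ _ hx
  · refine (Submodule.ne_bot_iff _).2 ⟨a, Submodule.subset_span ⟨1, by simp⟩, ha⟩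

theorem IsIrreducibleRep.eq_zero_of_coeff_eq_zero {σ : Representation ℂ G A}
    (hσ : IsIrreducibleRep σ) {α : Module.Dual ℂ A} (hα : α ≠ 0) {x : A}
    (hx : ∀ g, α (σ g x) = 0) : x = 0 := by
  by_contra hx0
  refine hα (LinearMap.ext fun y => ?_)
  have hy : y ∈ Submodule.span ℂ (Set.range fun g => σ g x) := by
    rw [hσ.span_orbit_eq_top hx0]; trivial
  refine (Submodule.span_le.2 ?_ : _ ≤ LinearMap.ker α) hy
  rintro _ ⟨g, rfl⟩
  exact hx g

/-- The external tensor product of two representations. -/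
def tensorRep (σ : Representation ℂ G A) (τ : Representation ℂ H B) :
    Representation ℂ (G × H) (A ⊗[ℂ] B) where
  toFun g := TensorProduct.map (σ g.1) (τ g.2)
  map_one' := by simp
  map_mul' g h := by simp [TensorProduct.map_mul]

theorem tensorRep_apply (σ : Representation ℂ G A) (τ : Representation ℂ H B) (g : G × H) :
    tensorRep σ τ g = TensorProduct.map (σ g.1) (τ g.2) := rfl

theorem span_orbit_tensorRep {σ : Representation ℂ G A} {τ : Representation ℂ H B} {a : A} {b : B}
    (ha : Submodule.span ℂ (Set.range fun g => σ g a) = ⊤)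
    (hb : Submodule.span ℂ (Set.range fun g => τ g b) = ⊤) :
    Submodule.span ℂ (Set.range fun g => tensorRep σ τ g (a ⊗ₜ b)) = ⊤ := by
  rw [← TensorProduct.map₂_mk_top_top_eq_top, ← ha, ← hb, Submodule.map₂_span_span]
  congr 1
  ext x
  simp [tensorRep_apply, Set.mem_image2]

/-- The tensor product of two functionals. -/
def tensorDual (α : Module.Dual ℂ A) (β : Module.Dual ℂ B) : Module.Dual ℂ (A ⊗[ℂ] B) :=
  LinearMap.mul' ℂ ℂ ∘ₗ TensorProduct.map α β

@[simp]
theorem tensorDual_tmul (α : Module.Dual ℂ A) (β : Module.Dual ℂ B) (a : A) (b : B) :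
    tensorDual α β (a ⊗ₜ b) = α a * β b := rfl

theorem span_translates_eq_top [FiniteDimensional ℂ A] {σ : Representation ℂ G A}
    {α : Module.Dual ℂ A} (hα : ∀ x, (∀ g, α (σ g x) = 0) → x = 0) :
    Submodule.span ℂ (Set.range fun g => α ∘ₗ σ g) = ⊤ := by
  have : (Submodule.span ℂ (Set.range fun g => α ∘ₗ σ g)).dualCoannihilator = ⊥ := by
    refine (Submodule.eq_bot_iff _).2 fun x hx => hα x fun g => ?_
    exact (Submodule.mem_dualCoannihilator x).1 hx _ (Submodule.subset_span ⟨g, rfl⟩)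
  rw [← Subspace.dualCoannihilator_dualAnnihilator_eq (W := Submodule.span ℂ _), this,
    Submodule.dualAnnihilator_bot]

theorem eq_zero_of_tensorDual_eq_zero [FiniteDimensional ℂ A] [FiniteDimensional ℂ B]
    {σ : Representation ℂ G A} {τ : Representation ℂ H B} {α : Module.Dual ℂ A}
    {β : Module.Dual ℂ B} (hα : ∀ x, (∀ g, α (σ g x) = 0) → x = 0)
    (hβ : ∀ x, (∀ g, β (τ g x) = 0) → x = 0) (x : A ⊗[ℂ] B)
    (hx : ∀ g, tensorDual α β (tensorRep σ τ g x) = 0) : x = 0 := by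
  have h1 : ∀ g h, tensorDual (α ∘ₗ σ g) (β ∘ₗ τ h) x = 0 := by
    intro g h
    rw [← hx (g, h)]
    exact LinearMap.congr_fun (TensorProduct.ext' fun a b => rfl :
      tensorDual (α ∘ₗ σ g) (β ∘ₗ τ h) = tensorDual α β ∘ₗ tensorRep σ τ (g, h)) x
  have h2 : ∀ m m', tensorDual m m' x = 0 := by
    intro m m'
    have hm : m ∈ Submodule.span ℂ (Set.range fun g => α ∘ₗ σ g) := by
      rw [span_translates_eq_top hα]; trivial
    have hm' : m' ∈ Submodule.span ℂ (Set.range fun g => β ∘ₗ τ g) := by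
      rw [span_translates_eq_top hβ]; trivial
    induction hm, hm' using Submodule.span_induction₂ with
    | mem_mem m m' hm hm' =>
      obtain ⟨g, rfl⟩ := hm
      obtain ⟨h, rfl⟩ := hm'
      exact h1 g h
    | zero_left m => simp [tensorDual]
    | zero_right m => simp [tensorDual]
    | add_left m m' k _ _ _ h h' =>
      simp only [tensorDual, TensorProduct.map_add_left, LinearMap.comp_add,
        LinearMap.add_apply] at *
      rw [h, h', add_zero]
    | add_right m m' k _ _ _ h h' =>
      simp only [tensorDual, TensorProduct.map_add_right, LinearMap.comp_add,
        LinearMap.add_apply] at *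
      rw [h, h', add_zero]
    | smul_left c m m' _ _ h =>
      simp only [tensorDual, TensorProduct.map_smul_left, LinearMap.comp_smul,
        LinearMap.smul_apply] at *
      rw [h, smul_zero]
    | smul_right c m m' _ _ h =>
      simp only [tensorDual, TensorProduct.map_smul_right, LinearMap.comp_smul,
        LinearMap.smul_apply] at *
      rw [h, smul_zero]
  let b := Module.finBasis ℂ A
  let c := Module.finBasis ℂ B
  refine (b.tensorProduct c).repr.map_eq_zero_iff.1 (Finsupp.ext fun ⟨i, j⟩ => ?_)
  have h3 : (b.tensorProduct c).coord (i, j) = tensorDual (b.coord i) (c.coord j) :=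
    TensorProduct.ext' fun x y => by
      simp [Module.Basis.tensorProduct_repr_tmul_apply, mul_comm]
  exact (LinearMap.congr_fun h3 x).trans (h2 _ _)

end Matching

section HighestWeight

variable {n : ℕ} {V : Type*} [AddCommGroup V] [Module ℂ V]

/-- `v` is fixed by the upper unipotent group. -/
def IsHighest (ρ : Representation ℂ (GL (Fin n) ℂ) V) (v : V) : Prop :=
  ∀ u : GL (Fin n) ℂ, IsUpperUni (u : Matrix (Fin n) (Fin n) ℂ) → ρ u v = v

/-- `l` is fixed by the lower unipotent group. -/
def IsLowest (ρ : Representation ℂ (GL (Fin n) ℂ) V) (l : Module.Dual ℂ V) : Prop :=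
  ∀ w : GL (Fin n) ℂ, IsUpperUni (w : Matrix (Fin n) (Fin n) ℂ) →
    ∀ x, l (ρ (glTranspose w) x) = l x

theorem IsLowest.apply_eq {ρ : Representation ℂ (GL (Fin n) ℂ) V} {l : Module.Dual ℂ V} {v : V}
    (hl : IsLowest ρ l) (hv : IsHighest ρ v) {w g u d : GL (Fin n) ℂ}
    (hw : IsUpperUni (w : Matrix (Fin n) (Fin n) ℂ))
    (hu : IsUpperUni (u : Matrix (Fin n) (Fin n) ℂ)) (h : glTranspose w * g * u = d) :
    l (ρ g v) = l (ρ d v) := by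
  rw [← h, map_mul, map_mul, Module.End.mul_apply, Module.End.mul_apply, hv u hu, hl w hw]

theorem exists_isLowest [FiniteDimensional ℂ V] [Nontrivial V]
    (ρ : Representation ℂ (GL (Fin n) ℂ) V) : ∃ l : Module.Dual ℂ V, l ≠ 0 ∧ IsLowest ρ l := by
  let τ : Representation ℂ (GL (Fin n) ℂ) (Module.Dual ℂ V) :=
    { toFun := fun g => Module.Dual.transpose (ρ (glTranspose g))
      map_one' := by ext; simp [Module.Dual.transpose_apply]
      map_mul' := fun g h => by
        ext l x
        simp [Module.Dual.transpose_apply, glTranspose_mul] }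
  obtain ⟨l, hl0, hl⟩ := exists_isUpperUni_fixed τ
  exact ⟨l, hl0, fun w hw x => LinearMap.congr_fun (hl w hw) x⟩

theorem IsGLHW.exists_coeff {a : Fin n → ℤ} {ρ : Representation ℂ (GL (Fin n) ℂ) V}
    (hρ : IsGLHW n a ρ) : ∃ (v : V) (l : Module.Dual ℂ V), l v = 1 ∧ v ≠ 0 ∧ l ≠ 0 ∧
      ∀ w g u d : GL (Fin n) ℂ, IsUpperUni (w : Matrix (Fin n) (Fin n) ℂ) →
        IsUpperUni (u : Matrix (Fin n) (Fin n) ℂ) → glTranspose w * g * u = d →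
        ∀ e : Fin n → ℂ, (d : Matrix (Fin n) (Fin n) ℂ) = diagonal e →
          l (ρ g v) = ∏ i, e i ^ a i := by
  obtain ⟨hirr, hfd, v, hv0, hv, hwt⟩ := hρ
  have := hirr.1
  obtain ⟨l, hl0, hl⟩ := exists_isLowest ρ
  have hlv : l v ≠ 0 := by
    intro h0
    refine hv0 (hirr.eq_zero_of_coeff_eq_zero hl0 ?_)
    refine IsPathPolynomial.eq_of_eq_on_bigCell (isPathPolynomial_coeff ρ l v)
      (fun _ _ _ => ⟨0, by simp⟩ : IsPathPolynomial fun _ => 0) ?_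
    rintro g ⟨w, u, d, hw, hu, h, e, he⟩
    rw [hl.apply_eq hv hw hu h, hwt d e he, map_smul, h0, smul_zero]
  refine ⟨v, (l v)⁻¹ • l, by simp [hlv], hv0, smul_ne_zero (inv_ne_zero hlv) hl0, ?_⟩
  intro w g u d hw hu h e he
  rw [LinearMap.smul_apply, hl.apply_eq hv hw hu h, hwt d e he, map_smul, smul_eq_mul, smul_eq_mul]
  field_simp

end HighestWeight

section Action

variable {n p : ℕ}

/-- Substitution of `Aᵀ X B` for the `n × p` matrix of variables `X`. -/
def matAct (A : Matrix (Fin n) (Fin n) ℂ) (B : Matrix (Fin p) (Fin p) ℂ) :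
    MvPolynomial (Fin n × Fin p) ℂ →ₐ[ℂ] MvPolynomial (Fin n × Fin p) ℂ :=
  MvPolynomial.aeval fun x => ∑ i, ∑ j, (A i x.1 * B j x.2) • MvPolynomial.X (i, j)

variable (n p) in
/-- The `n × p` matrix of variables. -/
def genMat : Matrix (Fin n) (Fin p) (MvPolynomial (Fin n × Fin p) ℂ) :=
  of fun i j => MvPolynomial.X (i, j)

/-- Evaluation of a polynomial at an `n × p` matrix. -/
def matEval {R : Type*} [CommRing R] [Algebra ℂ R] (X : Matrix (Fin n) (Fin p) R) :
    MvPolynomial (Fin n × Fin p) ℂ →ₐ[ℂ] R :=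
  MvPolynomial.aeval fun x => X x.1 x.2

theorem matAct_X (A : Matrix (Fin n) (Fin n) ℂ) (B : Matrix (Fin p) (Fin p) ℂ)
    (x : Fin n × Fin p) : matAct A B (MvPolynomial.X x) =
      ∑ i, ∑ j, (A i x.1 * B j x.2) • MvPolynomial.X (i, j) := by
  simp [matAct]

theorem genMat_map_matEval {R : Type*} [CommRing R] [Algebra ℂ R] (X : Matrix (Fin n) (Fin p) R) :
    (genMat n p).map (matEval X) = X := by
  ext i j
  simp [genMat, matEval]

theorem matEval_matAct (X : Matrix (Fin n) (Fin p) ℂ) (A : Matrix (Fin n) (Fin n) ℂ)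
    (B : Matrix (Fin p) (Fin p) ℂ) (F : MvPolynomial (Fin n × Fin p) ℂ) :
    matEval X (matAct A B F) = matEval (Aᵀ * X * B) F := by
  have : (matEval X).comp (matAct A B) = matEval (Aᵀ * X * B) := by
    refine MvPolynomial.algHom_ext fun x => ?_
    simp only [AlgHom.comp_apply, matAct_X, map_sum, map_smul, matEval, MvPolynomial.aeval_X,
      mul_apply, transpose_apply, Finset.sum_mul]
    rw [Finset.sum_comm]
    refine Finset.sum_congr rfl fun j _ => Finset.sum_congr rfl fun i _ => ?_
    rw [smul_eq_mul]
    ring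
  exact AlgHom.congr_fun this F

theorem matEval_funext {F F' : MvPolynomial (Fin n × Fin p) ℂ}
    (h : ∀ X : Matrix (Fin n) (Fin p) ℂ, matEval X F = matEval X F') : F = F' :=
  MvPolynomial.funext fun x => by
    simpa [matEval, MvPolynomial.coe_aeval_eq_eval] using h (of fun i j => x (i, j))

theorem matAct_mul (A A' : Matrix (Fin n) (Fin n) ℂ) (B B' : Matrix (Fin p) (Fin p) ℂ)
    (F : MvPolynomial (Fin n × Fin p) ℂ) :
    matAct (A * A') (B * B') F = matAct A B (matAct A' B' F) :=
  matEval_funext fun X => by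
    simp only [matEval_matAct, transpose_mul, Matrix.mul_assoc]

theorem matAct_one (F : MvPolynomial (Fin n × Fin p) ℂ) : matAct 1 1 F = F :=
  matEval_funext fun X => by simp [matEval_matAct]

variable (n p) in
/-- The action of `GL_n × GL_p` on polynomials on `n × p` matrices. -/
def polyRep : Representation ℂ (GL (Fin n) ℂ × GL (Fin p) ℂ) (MvPolynomial (Fin n × Fin p) ℂ) where
  toFun g := (matAct g.1.val g.2.val).toLinearMap
  map_one' := LinearMap.ext matAct_one
  map_mul' _ _ := LinearMap.ext fun F => matAct_mul _ _ _ _ F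

theorem polyRep_apply (g : GL (Fin n) ℂ) (h : GL (Fin p) ℂ) (F : MvPolynomial (Fin n × Fin p) ℂ) :
    polyRep n p (g, h) F = matAct g.val h.val F := rfl

theorem totalDegree_matAct_le (A : Matrix (Fin n) (Fin n) ℂ) (B : Matrix (Fin p) (Fin p) ℂ)
    (F : MvPolynomial (Fin n × Fin p) ℂ) : (matAct A B F).totalDegree ≤ F.totalDegree := by
  rw [matAct, MvPolynomial.aeval_def, MvPolynomial.eval₂_eq]
  refine MvPolynomial.totalDegree_finsetSum_le fun m hm => ?_
  refine (MvPolynomial.totalDegree_mul _ _).trans ?_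
  rw [MvPolynomial.algebraMap_eq, MvPolynomial.totalDegree_C, zero_add]
  refine (MvPolynomial.totalDegree_finsetProd _ _).trans
    (le_trans (Finset.sum_le_sum fun x _ => ?_) (MvPolynomial.le_totalDegree hm))
  refine (MvPolynomial.totalDegree_pow _ _).trans
    (le_trans (Nat.mul_le_mul_left _ ?_) (mul_one _).le)
  refine MvPolynomial.totalDegree_finsetSum_le fun i _ =>
    MvPolynomial.totalDegree_finsetSum_le fun j _ => ?_
  exact (MvPolynomial.totalDegree_smul_le _ _).trans (MvPolynomial.totalDegree_X _).le

/-- Coefficientwise complex conjugation. -/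
def polyConj : MvPolynomial (Fin n × Fin p) ℂ →+* MvPolynomial (Fin n × Fin p) ℂ :=
  MvPolynomial.map (starRingEnd ℂ)

theorem polyConj_matAct (A : Matrix (Fin n) (Fin n) ℂ) (B : Matrix (Fin p) (Fin p) ℂ)
    (F : MvPolynomial (Fin n × Fin p) ℂ) : polyConj (matAct A B F) =
      matAct (A.map (starRingEnd ℂ)) (B.map (starRingEnd ℂ)) (polyConj F) := by
  induction F using MvPolynomial.induction_on with
  | C a => simp [polyConj, matAct]
  | add F F' h h' => simp only [map_add, h, h']
  | mul_X F x h =>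
    rw [map_mul, map_mul, h, map_mul, map_mul]
    congr 1
    simp [polyConj, matAct_X, MvPolynomial.smul_eq_C_mul]

theorem polyConj_smul (c : ℂ) (F : MvPolynomial (Fin n × Fin p) ℂ) :
    polyConj (c • F) = starRingEnd ℂ c • polyConj F := by
  simp [polyConj, MvPolynomial.smul_eq_C_mul]

theorem totalDegree_polyConj_le (F : MvPolynomial (Fin n × Fin p) ℂ) :
    (polyConj F).totalDegree ≤ F.totalDegree :=
  Finset.sup_mono (MvPolynomial.support_map_subset _ _)

end Action

section Pairing

variable {σ : Type*} [Fintype σ]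

/-- The bilinear form on polynomials for which multiplication by variables is adjoint to
differentiation. -/
def polyPairing : MvPolynomial σ ℂ →ₗ[ℂ] MvPolynomial σ ℂ →ₗ[ℂ] ℂ :=
  (MvPolynomial.basisMonomials σ ℂ).constr ℂ fun m =>
    ((∏ i, (m i).factorial : ℕ) : ℂ) • MvPolynomial.lcoeff ℂ m

theorem polyPairing_monomial (m : σ →₀ ℕ) (a : ℂ) (q : MvPolynomial σ ℂ) :
    polyPairing (MvPolynomial.monomial m a) q =
      a * ((∏ i, (m i).factorial : ℕ) : ℂ) * q.coeff m := by
  have h : MvPolynomial.monomial m a = a • MvPolynomial.basisMonomials σ ℂ m := by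
    simp [MvPolynomial.smul_monomial]
  rw [h, map_smul, polyPairing, Module.Basis.constr_basis]
  simp only [LinearMap.smul_apply, smul_eq_mul, MvPolynomial.lcoeff]
  rw [mul_assoc]
  rfl

theorem polyPairing_C (a : ℂ) (q : MvPolynomial σ ℂ) :
    polyPairing (MvPolynomial.C a) q = a * MvPolynomial.constantCoeff q := by
  have := polyPairing_monomial 0 a q
  simpa [MvPolynomial.constantCoeff_eq] using this

theorem polyPairing_mul_X (f q : MvPolynomial σ ℂ) (x : σ) :
    polyPairing (f * MvPolynomial.X x) q = polyPairing f (MvPolynomial.pderiv x q) := by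
  classical
  induction f using MvPolynomial.induction_on' with
  | monomial m a =>
    rw [MvPolynomial.X, MvPolynomial.monomial_mul, mul_one, polyPairing_monomial,
      polyPairing_monomial, MvPolynomial.coeff_pderiv]
    have : ∏ i, ((m + Finsupp.single x 1 : σ →₀ ℕ) i).factorial =
        (∏ i, (m i).factorial) * (m x + 1) := by
      rw [← Finset.mul_prod_erase _ _ (Finset.mem_univ x),
        ← Finset.mul_prod_erase _ (fun i => (m i).factorial) (Finset.mem_univ x)]
      have : ∏ i ∈ Finset.univ.erase x, ((m + Finsupp.single x 1 : σ →₀ ℕ) i).factorial =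
          ∏ i ∈ Finset.univ.erase x, (m i).factorial :=
        Finset.prod_congr rfl fun i hi => by
          simp [(Finset.ne_of_mem_erase hi).symm]
      rw [this]
      simp [Nat.factorial_succ]
      ring
    rw [this]
    push_cast
    ring
  | add f g hf hg =>
    rw [add_mul, map_add, map_add, LinearMap.add_apply, LinearMap.add_apply, hf, hg]

theorem polyPairing_comm (f q : MvPolynomial σ ℂ) : polyPairing f q = polyPairing q f := by
  classical
  induction f using MvPolynomial.induction_on' with
  | monomial m a =>
    induction q using MvPolynomial.induction_on' with
    | monomial k b =>
      rw [polyPairing_monomial, polyPairing_monomial, MvPolynomial.coeff_monomial,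
        MvPolynomial.coeff_monomial]
      by_cases h : k = m
      · subst h; simp; ring
      · simp [h, Ne.symm h]
    | add f g hf hg => simp only [map_add, LinearMap.add_apply, hf, hg]
  | add f g hf hg => simp only [map_add, LinearMap.add_apply, hf, hg]

theorem eq_zero_of_polyPairing_conj (q : MvPolynomial σ ℂ)
    (h : polyPairing q (MvPolynomial.map (starRingEnd ℂ) q) = 0) : q = 0 := by
  have h1 : ((∑ m ∈ q.support, (∏ i, (m i).factorial : ℕ) * Complex.normSq (q.coeff m) : ℝ) : ℂ)
      = 0 := by
    rw [← h]
    conv_rhs => rw [q.as_sum]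
    rw [map_sum, LinearMap.sum_apply, Complex.ofReal_sum]
    refine Finset.sum_congr rfl fun m _ => ?_
    rw [← q.as_sum, polyPairing_monomial, MvPolynomial.coeff_map, Complex.ofReal_mul,
      Complex.normSq_eq_conj_mul_self, Complex.ofReal_natCast]
    ring
  rw [Complex.ofReal_eq_zero, Finset.sum_eq_zero_iff_of_nonneg fun m _ =>
    mul_nonneg (Nat.cast_nonneg _) (Complex.normSq_nonneg _)] at h1
  by_contra hq
  obtain ⟨m, hm⟩ := Finset.nonempty_iff_ne_empty.2 (mt MvPolynomial.support_eq_empty.1 hq)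
  have h2 := h1 m hm
  rw [mul_eq_zero, Complex.normSq_eq_zero, Nat.cast_eq_zero,
    Finset.prod_eq_zero_iff] at h2
  rcases h2 with ⟨i, -, hi⟩ | h2
  · exact Nat.factorial_ne_zero _ hi
  · exact MvPolynomial.mem_support_iff.1 hm h2

end Pairing

section Adjoint

variable {n p : ℕ}

theorem pderiv_matAct (A : Matrix (Fin n) (Fin n) ℂ) (B : Matrix (Fin p) (Fin p) ℂ)
    (q : MvPolynomial (Fin n × Fin p) ℂ) (x : Fin n × Fin p) :
    MvPolynomial.pderiv x (matAct A B q) =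
      ∑ i, ∑ j, (A x.1 i * B x.2 j) • matAct A B (MvPolynomial.pderiv (i, j) q) := by
  induction q using MvPolynomial.induction_on with
  | C a => simp [matAct]
  | add f g hf hg =>
    simp only [map_add, hf, hg, smul_add, Finset.sum_add_distrib]
  | mul_X f y hf =>
    have h1 : MvPolynomial.pderiv x (matAct A B (MvPolynomial.X y)) =
        MvPolynomial.C (A x.1 y.1 * B x.2 y.2) := by
      rw [matAct_X, map_sum, Finset.sum_eq_single x.1, map_sum, Finset.sum_eq_single x.2]
      · simp [MvPolynomial.smul_eq_C_mul]
      · intro j _ hj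
        rw [Derivation.map_smul, MvPolynomial.pderiv_X_of_ne, smul_zero]
        exact fun h => hj (congrArg Prod.snd h)
      · simp
      · intro i _ hi
        rw [map_sum]
        refine Finset.sum_eq_zero fun j _ => ?_
        rw [Derivation.map_smul, MvPolynomial.pderiv_X_of_ne, smul_zero]
        exact fun h => hi (congrArg Prod.fst h)
      · simp
    have h2 : ∑ i, ∑ j, (A x.1 i * B x.2 j) •
        matAct A B (f * MvPolynomial.pderiv (i, j) (MvPolynomial.X y)) =
          matAct A B f * MvPolynomial.C (A x.1 y.1 * B x.2 y.2) := by
      rw [Finset.sum_eq_single y.1, Finset.sum_eq_single y.2]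
      · simp [MvPolynomial.smul_eq_C_mul, mul_comm]
      · intro j _ hj
        rw [MvPolynomial.pderiv_X_of_ne, mul_zero, map_zero, smul_zero]
        exact fun h => hj (congrArg Prod.snd h).symm
      · simp
      · intro i _ hi
        refine Finset.sum_eq_zero fun j _ => ?_
        rw [MvPolynomial.pderiv_X_of_ne, mul_zero, map_zero, smul_zero]
        exact fun h => hi (congrArg Prod.fst h).symm
      · simp
    rw [map_mul, MvPolynomial.pderiv_mul, hf, h1, ← h2, Finset.sum_mul, ← Finset.sum_add_distrib]
    refine Finset.sum_congr rfl fun i _ => ?_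
    rw [Finset.sum_mul, ← Finset.sum_add_distrib]
    refine Finset.sum_congr rfl fun j _ => ?_
    rw [MvPolynomial.pderiv_mul, map_add, map_mul, map_mul, smul_add, smul_mul_assoc]

theorem polyPairing_matAct (A : Matrix (Fin n) (Fin n) ℂ) (B : Matrix (Fin p) (Fin p) ℂ)
    (f q : MvPolynomial (Fin n × Fin p) ℂ) :
    polyPairing (matAct A B f) q = polyPairing f (matAct Aᵀ Bᵀ q) := by
  induction f using MvPolynomial.induction_on generalizing q with
  | C a =>
    have h : MvPolynomial.constantCoeff (matAct Aᵀ Bᵀ q) = MvPolynomial.constantCoeff q := by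
      induction q using MvPolynomial.induction_on with
      | C a => simp [matAct]
      | add f g hf hg => simp only [map_add, hf, hg]
      | mul_X f y hf => simp [matAct_X, MvPolynomial.constantCoeff_smul]
    have h' : matAct A B (MvPolynomial.C a) = MvPolynomial.C a := by simp [matAct]
    rw [h', polyPairing_C, polyPairing_C, h]
  | add f g hf hg => simp only [map_add, LinearMap.add_apply, hf, hg]
  | mul_X f x hf =>
    rw [map_mul, matAct_X, polyPairing_mul_X, pderiv_matAct]
    simp only [Finset.mul_sum, map_sum, LinearMap.sum_apply, mul_smul_comm, map_smul,
      LinearMap.smul_apply, polyPairing_mul_X, hf, transpose_apply]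

end Adjoint

section Minors

variable {n p : ℕ}

theorem matEval_leadMinor {R : Type*} [CommRing R] [Algebra ℂ R] (X : Matrix (Fin n) (Fin p) R)
    {k : ℕ} (hk : k ≤ min n p) : matEval X (leadMinor (genMat n p) hk) = leadMinor X hk := by
  conv_rhs => rw [← genMat_map_matEval X]
  exact (leadMinor_map (matEval X).toRingHom _ hk).symm

/-- The diagonal entries of a matrix, followed by ones. -/
def diagSeq {N : ℕ} (A : Matrix (Fin N) (Fin N) ℂ) (i : ℕ) : ℂ :=
  if h : i < N then A ⟨i, h⟩ ⟨i, h⟩ else 1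

theorem prod_castLE_diag {N k : ℕ} (A : Matrix (Fin N) (Fin N) ℂ) (hk : k ≤ N) :
    ∏ i : Fin k, A (Fin.castLE hk i) (Fin.castLE hk i) = ∏ i ∈ Finset.range k, diagSeq A i := by
  rw [Finset.prod_range]
  refine Finset.prod_congr rfl fun i _ => ?_
  rw [diagSeq, dif_pos (i.2.trans_le hk)]
  rfl

theorem matAct_leadMinor {A : Matrix (Fin n) (Fin n) ℂ} {B : Matrix (Fin p) (Fin p) ℂ}
    (hA : A.IsUpperTriangular) (hB : B.IsUpperTriangular) {k : ℕ} (hk : k ≤ min n p) :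
    matAct A B (leadMinor (genMat n p) hk) =
      (∏ i ∈ Finset.range k, diagSeq A i * diagSeq B i) • leadMinor (genMat n p) hk := by
  refine matEval_funext fun X => ?_
  rw [matEval_matAct, map_smul, matEval_leadMinor, matEval_leadMinor, leadMinor_mul_upper _ _ hB,
    leadMinor_upper_transpose_mul _ _ hA, prod_castLE_diag, prod_castLE_diag,
    Finset.prod_mul_distrib, smul_eq_mul]
  ring

variable (n p) in
/-- Products of powers of the leading minors of the matrix of variables. -/
def minorProd (m : ℕ → ℕ) : MvPolynomial (Fin n × Fin p) ℂ :=
  ∏ i : Fin (min n p), leadMinor (genMat n p) (Nat.succ_le_of_lt i.2) ^ m i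

theorem matAct_minorProd {A : Matrix (Fin n) (Fin n) ℂ} {B : Matrix (Fin p) (Fin p) ℂ}
    (hA : A.IsUpperTriangular) (hB : B.IsUpperTriangular) (m : ℕ → ℕ) :
    matAct A B (minorProd n p m) = (∏ i ∈ Finset.range (min n p),
      (∏ j ∈ Finset.range (i + 1), diagSeq A j * diagSeq B j) ^ m i) • minorProd n p m := by
  rw [minorProd, map_prod, Finset.prod_range, ← Finset.prod_smul]
  refine Finset.prod_congr rfl fun i _ => ?_
  rw [map_pow, matAct_leadMinor hA hB, smul_pow]

theorem matAct_minorProd_of_isUpperUni {A : Matrix (Fin n) (Fin n) ℂ}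
    {B : Matrix (Fin p) (Fin p) ℂ} (hA : IsUpperUni A) (hB : IsUpperUni B) (m : ℕ → ℕ) :
    matAct A B (minorProd n p m) = minorProd n p m := by
  have h : ∀ {N : ℕ} {A : Matrix (Fin N) (Fin N) ℂ}, IsUpperUni A → ∀ i, diagSeq A i = 1 := by
    intro N A hA i
    rw [diagSeq]
    split_ifs
    · exact hA.1 _
    · rfl
  rw [matAct_minorProd hA.isUpperTriangular hB.isUpperTriangular]
  simp [h hA, h hB]

theorem polyConj_minorProd (m : ℕ → ℕ) : polyConj (minorProd n p m) = minorProd n p m := by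
  rw [minorProd, map_prod]
  refine Finset.prod_congr rfl fun i _ => ?_
  rw [map_pow, ← leadMinor_map polyConj]
  congr 2
  ext1 a b
  simp [genMat, polyConj]

variable (n p) in
/-- The rectangular identity matrix. -/
def rectOne : Matrix (Fin n) (Fin p) ℂ := of fun i j => if (i : ℕ) = j then 1 else 0

theorem leadMinor_rectOne {k : ℕ} (hk : k ≤ min n p) : leadMinor (rectOne n p) hk = 1 := by
  rw [leadMinor_eq_prod_of_diag _ (fun i j h => by simp [rectOne, h])]
  simp [rectOne]

theorem minorProd_ne_zero (m : ℕ → ℕ) : minorProd n p m ≠ 0 := by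
  intro h
  have := congrArg (matEval (rectOne n p)) h
  rw [minorProd, map_prod, map_zero] at this
  simp [matEval_leadMinor, leadMinor_rectOne] at this

theorem prod_pow_sub_eq (f : ℕ → ℕ) (hf : Antitone f) (y : ℕ → ℂ) (m : ℕ) :
    (∏ i ∈ Finset.range m, (∏ j ∈ Finset.range (i + 1), y j) ^ (f i - f (i + 1))) *
      (∏ j ∈ Finset.range m, y j) ^ f m = ∏ j ∈ Finset.range m, y j ^ f j := by
  induction m with
  | zero => simp
  | succ m ih =>
    rw [Finset.prod_range_succ, mul_assoc, ← pow_add, Nat.sub_add_cancel (hf m.le_succ),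
      Finset.prod_range_succ, mul_pow, ← mul_assoc, ih, ← Finset.prod_range_succ]

theorem PtnLe.antitone {c : ℕ} (l : PtnLe c) : Antitone l.1 := fun _ _ h => l.2.1.1 h

theorem PtnLe.eq_zero {c : ℕ} (l : PtnLe c) {i : ℕ} (hi : c ≤ i) : l.1 i = 0 := by
  have h : l.1 (plen l.1) = 0 := Nat.sInf_mem (s := {k | l.1 k = 0}) l.2.1.2
  exact Nat.le_zero.1 (h ▸ l.antitone (l.2.2.trans hi))

/-- The highest weight polynomial attached to a partition. -/
def hwPoly (l : PtnLe (min n p)) : MvPolynomial (Fin n × Fin p) ℂ :=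
  minorProd n p fun i => l.1 i - l.1 (i + 1)

theorem prod_diagSeq_pow {N c : ℕ} (hc : c ≤ N) (l : PtnLe c) (e : Fin N → ℂ) :
    ∏ i ∈ Finset.range c, diagSeq (diagonal e) i ^ l.1 i = ∏ i, e i ^ polyWeight N l.1 i := by
  rw [Finset.prod_subset (Finset.range_mono hc) fun i _ hi => by
    rw [l.eq_zero (by simpa using hi), pow_zero], Finset.prod_range]
  refine Finset.prod_congr rfl fun i _ => ?_
  simp [diagSeq, polyWeight]

theorem matAct_diagonal_hwPoly (l : PtnLe (min n p)) (e : Fin n → ℂ) (e' : Fin p → ℂ) :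
    matAct (diagonal e) (diagonal e') (hwPoly l) =
      ((∏ i, e i ^ polyWeight n l.1 i) * ∏ j, e' j ^ polyWeight p l.1 j) • hwPoly l := by
  have h := prod_pow_sub_eq l.1 l.antitone
    (fun j => diagSeq (diagonal e) j * diagSeq (diagonal e') j) (min n p)
  rw [l.eq_zero le_rfl, pow_zero, mul_one] at h
  rw [hwPoly, matAct_minorProd (blockTriangular_diagonal _) (blockTriangular_diagonal _), h]
  simp only [mul_pow]
  rw [Finset.prod_mul_distrib, prod_diagSeq_pow (min_le_left n p) l,
    prod_diagSeq_pow (min_le_right n p) l]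

theorem exists_hwPoly_eq_minorProd (m : ℕ → ℕ) :
    ∃ l : PtnLe (min n p), hwPoly l = minorProd n p m := by
  let f : ℕ → ℕ := fun i => ∑ j ∈ Finset.Ico i (min n p), m j
  have hf : f (min n p) = 0 := by simp [f]
  refine ⟨⟨f, ⟨fun i j hij => ?_, min n p, hf⟩, Nat.sInf_le hf⟩, ?_⟩
  · exact Finset.sum_le_sum_of_subset (Finset.Ico_subset_Ico_left hij)
  · change minorProd n p (fun i => f i - f (i + 1)) = _
    rw [minorProd, minorProd]
    refine Finset.prod_congr rfl fun i _ => ?_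
    congr 1
    show f i - f (i + 1) = m i
    simp only [f]
    rw [Finset.sum_eq_sum_Ico_succ_bot i.2, Nat.add_sub_cancel]

variable (n p) in
/-- A matrix with prescribed leading minors. -/
def minorSection {R : Type*} [CommRing R] (y : Fin (min n p) → R) : Matrix (Fin n) (Fin p) R :=
  of fun i j => if (j : ℕ) = 0 then
      (if h : (i : ℕ) < min n p then (-1) ^ (i : ℕ) * y ⟨i, h⟩ else 0)
    else if (j : ℕ) = i + 1 then 1 else 0

theorem leadMinor_zero {R : Type*} [CommRing R] (X : Matrix (Fin n) (Fin p) R)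
    (h : 0 ≤ min n p) : leadMinor X h = 1 := det_isEmpty

theorem leadMinor_minorSection {R : Type*} [CommRing R] (y : Fin (min n p) → R)
    (i : Fin (min n p)) : leadMinor (minorSection n p y) (Nat.succ_le_of_lt i.2) = y i := by
  rw [leadMinor, det_succ_row _ (Fin.last i), Finset.sum_eq_single 0]
  · have h : (leadBlock (minorSection n p y) (Nat.succ_le_of_lt i.2)).submatrix
        (Fin.last (i : ℕ)).succAbove (Fin.succAbove 0) = 1 := by
      ext a b
      simp [leadBlock, minorSection, one_apply, Fin.ext_iff, eq_comm]
    rw [h, det_one]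
    have hi : ¬ p ≤ (i : ℕ) := (i.2.trans_le (min_le_right n p)).not_ge
    simp [leadBlock, minorSection, ← mul_assoc, ← mul_pow, hi]
  · intro j _ hj
    have hj' : (j : ℕ) ≠ 0 := fun h => hj (Fin.ext h)
    have hj2 : (j : ℕ) ≠ i + 1 := j.2.ne
    simp [leadBlock, minorSection, hj', hj2]
  · simp

theorem matEval_eq_of_leadMinor_eq {F : MvPolynomial (Fin n × Fin p) ℂ}
    (hF : ∀ (w : GL (Fin n) ℂ) (u : GL (Fin p) ℂ), IsUpperUni w.val → IsUpperUni u.val →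
      matAct w.val u.val F = F) {X Y : Matrix (Fin n) (Fin p) ℂ}
    (hX : ∀ k (hk : k ≤ min n p), leadMinor X hk ≠ 0)
    (hXY : ∀ k (hk : k ≤ min n p), leadMinor X hk = leadMinor Y hk) :
    matEval X F = matEval Y F := by
  have hinv : ∀ (X : Matrix (Fin n) (Fin p) ℂ) (w : Matrix (Fin n) (Fin n) ℂ)
      (u : Matrix (Fin p) (Fin p) ℂ), IsUpperUni w → IsUpperUni u →
      matEval (wᵀ * X * u) F = matEval X F := by
    intro X w u hw hu
    rw [← matEval_matAct]
    congr 1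
    exact hF (GeneralLinearGroup.mkOfDetNeZero w (by simp [hw.det]))
      (GeneralLinearGroup.mkOfDetNeZero u (by simp [hu.det])) hw hu
  obtain ⟨w, u, hw, hu, hJ⟩ := exists_isUpperUni_diag X hX
  obtain ⟨w', u', hw', hu', hK⟩ := exists_isUpperUni_diag Y fun k hk => hXY k hk ▸ hX k hk
  rw [← hinv X w u hw hu, ← hinv Y w' u' hw' hu']
  congr 2
  refine eq_of_leadMinor_eq_of_diag _ _ hJ hK (fun k hk => ?_) fun k hk => ?_
  · rw [leadMinor_isUpperUni_mul_mul X hw hu]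
    exact hX k hk
  · rw [leadMinor_isUpperUni_mul_mul X hw hu, leadMinor_isUpperUni_mul_mul Y hw' hu', hXY]

/-- Polynomials invariant under both unipotent groups are polynomials in the leading minors. -/
theorem mem_span_hwPoly {F : MvPolynomial (Fin n × Fin p) ℂ}
    (hF : ∀ (w : GL (Fin n) ℂ) (u : GL (Fin p) ℂ), IsUpperUni w.val → IsUpperUni u.val →
      matAct w.val u.val F = F) :
    F ∈ Submodule.span ℂ (Set.range (hwPoly (n := n) (p := p))) := by
  let Δ : Fin (min n p) → MvPolynomial (Fin n × Fin p) ℂ := fun i =>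
    leadMinor (genMat n p) (Nat.succ_le_of_lt i.2)
  let Q : MvPolynomial (Fin (min n p)) ℂ := matEval (minorSection n p MvPolynomial.X) F
  have hQ : ∀ X : Matrix (Fin n) (Fin p) ℂ, matEval X (MvPolynomial.aeval Δ Q) =
      matEval (minorSection n p fun i => matEval X (Δ i)) F := by
    intro X
    have : ((matEval X).comp (MvPolynomial.aeval Δ)).comp
        (matEval (minorSection n p MvPolynomial.X)) =
          matEval (minorSection n p fun i => matEval X (Δ i)) := by
      refine MvPolynomial.algHom_ext fun x => ?_
      simp only [AlgHom.comp_apply, matEval, MvPolynomial.aeval_X, minorSection, of_apply]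
      split_ifs <;> simp
    exact AlgHom.congr_fun this F
  have hΔ : minorProd n p (fun _ => 1) * F =
      minorProd n p (fun _ => 1) * MvPolynomial.aeval Δ Q := by
    refine matEval_funext fun X => ?_
    rw [map_mul, map_mul, hQ]
    by_cases h0 : matEval X (minorProd n p fun _ => 1) = 0
    · rw [h0, zero_mul, zero_mul]
    · congr 1
      rw [minorProd, map_prod, ← ne_eq, Finset.prod_ne_zero_iff] at h0
      refine matEval_eq_of_leadMinor_eq hF ?_ ?_
      · rintro (_ | k) hk
        · rw [leadMinor_zero]; exact one_ne_zero
        · have := h0 ⟨k, hk⟩ (Finset.mem_univ _)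
          rwa [pow_one, matEval_leadMinor] at this
      · rintro (_ | k) hk
        · rw [leadMinor_zero, leadMinor_zero]
        · rw [leadMinor_minorSection _ ⟨k, hk⟩]
          exact (matEval_leadMinor X hk).symm
  rw [mul_left_cancel₀ (minorProd_ne_zero _) hΔ]
  induction Q using MvPolynomial.induction_on' with
  | monomial m a =>
    obtain ⟨l, hl⟩ := exists_hwPoly_eq_minorProd (n := n) (p := p)
      fun i => if h : i < min n p then m ⟨i, h⟩ else 0
    have : MvPolynomial.aeval Δ (MvPolynomial.monomial m a) = a • hwPoly l := by
      rw [hl, MvPolynomial.aeval_monomial, Finsupp.prod_fintype _ _ (by simp),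
        Algebra.smul_def, minorProd]
      congr 1
      refine Finset.prod_congr rfl fun i _ => ?_
      rw [dif_pos i.2]
    rw [this]
    exact Submodule.smul_mem _ _ (Submodule.subset_span ⟨l, rfl⟩)
  | add f g hf hg => rw [map_add]; exact Submodule.add_mem _ hf hg

end Minors

section Duality

variable {n p : ℕ}

theorem isPathPolynomial_polyRep_comp {N : ℕ} (φ : GL (Fin N) ℂ →* GL (Fin n) ℂ × GL (Fin p) ℂ)
    (l : Module.Dual ℂ (MvPolynomial (Fin n × Fin p) ℂ)) (F : MvPolynomial (Fin n × Fin p) ℂ) :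
    IsPathPolynomial fun g => l (polyRep n p (φ g) F) := by
  let W := MvPolynomial.restrictTotalDegree (Fin n × Fin p) ℂ F.totalDegree
  have hW : ∀ g, W ≤ W.comap (((polyRep n p).comp φ) g) := fun g x hx =>
    (MvPolynomial.mem_restrictTotalDegree _ _ _).2 ((totalDegree_matAct_le _ _ x).trans
      ((MvPolynomial.mem_restrictTotalDegree _ _ _).1 hx))
  exact isPathPolynomial_coeff (Representation.subrepresentation ((polyRep n p).comp φ) W hW)
    (l ∘ₗ W.subtype) ⟨F, (MvPolynomial.mem_restrictTotalDegree _ _ _).2 le_rfl⟩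

theorem isPathPolynomial_polyRep_left (l : Module.Dual ℂ (MvPolynomial (Fin n × Fin p) ℂ))
    (F : MvPolynomial (Fin n × Fin p) ℂ) (h : GL (Fin p) ℂ) :
    IsPathPolynomial fun g => l (polyRep n p (g, h) F) := by
  have := isPathPolynomial_polyRep_comp (MonoidHom.inl _ _) l (polyRep n p (1, h) F)
  simpa [← Module.End.mul_apply, ← map_mul] using this

theorem isPathPolynomial_polyRep_right (l : Module.Dual ℂ (MvPolynomial (Fin n × Fin p) ℂ))
    (F : MvPolynomial (Fin n × Fin p) ℂ) (g : GL (Fin n) ℂ) :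
    IsPathPolynomial fun h => l (polyRep n p (g, h) F) := by
  have := isPathPolynomial_polyRep_comp (MonoidHom.inr _ _) l (polyRep n p (g, 1) F)
  simpa [← Module.End.mul_apply, ← map_mul] using this

theorem eq_of_eq_on_bigCell_prod {φ ψ : GL (Fin n) ℂ → GL (Fin p) ℂ → ℂ}
    (hφ : ∀ h, IsPathPolynomial fun g => φ g h) (hφ' : ∀ g, IsPathPolynomial (φ g))
    (hψ : ∀ h, IsPathPolynomial fun g => ψ g h) (hψ' : ∀ g, IsPathPolynomial (ψ g))
    (heq : ∀ g h, InBigCell g → InBigCell h → φ g h = ψ g h) (g : GL (Fin n) ℂ)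
    (h : GL (Fin p) ℂ) : φ g h = ψ g h :=
  IsPathPolynomial.eq_of_eq_on_bigCell (hφ' g) (hψ' g) (fun h hh =>
    IsPathPolynomial.eq_of_eq_on_bigCell (hφ h) (hψ h) (fun g hg => heq g h hg hh) g) h

theorem polyPairing_polyRep (g : GL (Fin n) ℂ) (h : GL (Fin p) ℂ)
    (f q : MvPolynomial (Fin n × Fin p) ℂ) :
    polyPairing (polyRep n p (g, h) f) q =
      polyPairing f (polyRep n p (glTranspose g, glTranspose h) q) :=
  polyPairing_matAct _ _ f q

theorem polyRep_hwPoly_of_isUpperUni {g : GL (Fin n) ℂ} {h : GL (Fin p) ℂ}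
    (hg : IsUpperUni g.val) (hh : IsUpperUni h.val) (l : PtnLe (min n p)) :
    polyRep n p (g, h) (hwPoly l) = hwPoly l :=
  matAct_minorProd_of_isUpperUni hg hh _

theorem polyRep_hwPoly_of_diagonal {g : GL (Fin n) ℂ} {h : GL (Fin p) ℂ} {e : Fin n → ℂ}
    {e' : Fin p → ℂ} (hg : g.val = diagonal e) (hh : h.val = diagonal e')
    (l : PtnLe (min n p)) : polyRep n p (g, h) (hwPoly l) =
      ((∏ i, e i ^ polyWeight n l.1 i) * ∏ j, e' j ^ polyWeight p l.1 j) • hwPoly l := by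
  rw [polyRep_apply, hg, hh, matAct_diagonal_hwPoly]

theorem polyPairing_polyRep_hwPoly_of_bigCell (l l' : PtnLe (min n p))
    {w g u d : GL (Fin n) ℂ} (hw : IsUpperUni w.val) (hu : IsUpperUni u.val)
    (hd : glTranspose w * g * u = d) {w' h u' d' : GL (Fin p) ℂ} (hw' : IsUpperUni w'.val)
    (hu' : IsUpperUni u'.val) (hd' : glTranspose w' * h * u' = d') {e : Fin n → ℂ}
    (he : d.val = diagonal e) {e' : Fin p → ℂ} (he' : d'.val = diagonal e') :
    polyPairing (polyRep n p (g, h) (hwPoly l)) (hwPoly l') =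
      ((∏ i, e i ^ polyWeight n l.1 i) * ∏ j, e' j ^ polyWeight p l.1 j) *
        polyPairing (hwPoly l) (hwPoly l') := by
  conv_lhs => rw [← polyRep_hwPoly_of_isUpperUni hu hu' l, ← polyRep_hwPoly_of_isUpperUni hw hw' l']
  have h1 := polyPairing_polyRep (glTranspose w) (glTranspose w')
    (polyRep n p (g, h) (polyRep n p (u, u') (hwPoly l))) (hwPoly l')
  rw [glTranspose_glTranspose, glTranspose_glTranspose] at h1
  rw [← h1, ← Module.End.mul_apply, ← Module.End.mul_apply, ← map_mul, ← map_mul, Prod.mk_mul_mk,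
    Prod.mk_mul_mk, hd, hd', polyRep_hwPoly_of_diagonal he he', map_smul, LinearMap.smul_apply,
    smul_eq_mul]

theorem polyPairing_hwPoly_of_ne {l l' : PtnLe (min n p)} (hl : l ≠ l') :
    polyPairing (hwPoly l) (hwPoly l' : MvPolynomial (Fin n × Fin p) ℂ) = 0 := by
  obtain ⟨i, hi⟩ : ∃ i, l.1 i ≠ l'.1 i := by
    by_contra! h
    exact hl (Subtype.ext (funext h))
  have him : i < min n p := by
    by_contra! h
    exact hi (by rw [l.eq_zero h, l'.eq_zero h])
  let e : Fin n → ℂ := Function.update 1 ⟨i, him.trans_le (min_le_left n p)⟩ 2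
  have hwt : ∀ k : PtnLe (min n p), ∏ j, e j ^ polyWeight n k.1 j = 2 ^ k.1 i := by
    intro k
    rw [Finset.prod_eq_single ⟨i, him.trans_le (min_le_left n p)⟩]
    · simp [e, polyWeight]
    · intro j _ hj
      simp [e, hj]
    · simp
  have h := polyPairing_matAct (diagonal e) (diagonal 1) (hwPoly l) (hwPoly l')
  rw [diagonal_transpose, diagonal_transpose, matAct_diagonal_hwPoly, matAct_diagonal_hwPoly,
    hwt, hwt, map_smul, map_smul, LinearMap.smul_apply] at h
  simp only [Pi.one_apply, _root_.one_zpow, Finset.prod_const_one, mul_one, smul_eq_mul] at h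
  by_contra h0
  have h2 := mul_right_cancel₀ h0 h
  exact hi (Nat.pow_right_injective le_rfl (by exact_mod_cast h2))

theorem polyPairing_hwPoly_self_ne_zero (l : PtnLe (min n p)) :
    polyPairing (hwPoly l) (hwPoly l : MvPolynomial (Fin n × Fin p) ℂ) ≠ 0 := by
  intro h
  refine minorProd_ne_zero _ (eq_zero_of_polyPairing_conj (hwPoly l) ?_)
  rwa [show MvPolynomial.map (starRingEnd ℂ) (hwPoly l) = hwPoly l from polyConj_minorProd _]

theorem polyPairing_polyRep_hwPoly_of_ne {l l' : PtnLe (min n p)} (hl : l ≠ l')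
    (g : GL (Fin n) ℂ × GL (Fin p) ℂ) :
    polyPairing (polyRep n p g (hwPoly l)) (hwPoly l') = 0 := by
  obtain ⟨g, h⟩ := g
  have h1 : ∀ h, IsPathPolynomial fun g =>
      polyPairing.flip (hwPoly l') (polyRep n p (g, h) (hwPoly l)) :=
    isPathPolynomial_polyRep_left (polyPairing.flip (hwPoly l')) (hwPoly l)
  have h2 : ∀ g, IsPathPolynomial fun h =>
      polyPairing.flip (hwPoly l') (polyRep n p (g, h) (hwPoly l)) :=
    isPathPolynomial_polyRep_right (polyPairing.flip (hwPoly l')) (hwPoly l)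
  refine eq_of_eq_on_bigCell_prod (ψ := fun _ _ => 0) h1 h2 (fun _ _ _ _ => ⟨0, by simp⟩)
    (fun _ _ _ _ => ⟨0, by simp⟩) ?_ g h
  rintro g h ⟨w, u, d, hw, hu, hd, e, he⟩ ⟨w', u', d', hw', hu', hd', e', he'⟩
  rw [LinearMap.flip_apply,
    polyPairing_polyRep_hwPoly_of_bigCell l l' hw hu hd hw' hu' hd' he he',
    polyPairing_hwPoly_of_ne hl, mul_zero]

/-- The subrepresentation generated by a highest weight polynomial. -/
def hwModule (l : PtnLe (min n p)) : Submodule ℂ (MvPolynomial (Fin n × Fin p) ℂ) :=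
  Submodule.span ℂ (Set.range fun g => polyRep n p g (hwPoly l))

theorem hwPoly_mem_hwModule (l : PtnLe (min n p)) : hwPoly l ∈ hwModule (n := n) (p := p) l :=
  Submodule.subset_span ⟨1, by simp⟩

theorem polyRep_mem_hwModule {l : PtnLe (min n p)} {x : MvPolynomial (Fin n × Fin p) ℂ}
    (hx : x ∈ hwModule l) (g : GL (Fin n) ℂ × GL (Fin p) ℂ) : polyRep n p g x ∈ hwModule l := by
  induction hx using Submodule.span_induction with
  | mem x hx =>
    obtain ⟨k, rfl⟩ := hx
    exact Submodule.subset_span ⟨g * k, by simp⟩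
  | zero => simp
  | add x y _ _ hx hy => rw [map_add]; exact Submodule.add_mem _ hx hy
  | smul c x _ hx => rw [map_smul]; exact Submodule.smul_mem _ _ hx

theorem polyConj_mem_hwModule {l : PtnLe (min n p)} {x : MvPolynomial (Fin n × Fin p) ℂ}
    (hx : x ∈ hwModule l) : polyConj x ∈ hwModule l := by
  induction hx using Submodule.span_induction with
  | mem x hx =>
    obtain ⟨k, rfl⟩ := hx
    refine Submodule.subset_span ⟨(GeneralLinearGroup.map (starRingEnd ℂ) k.1,
      GeneralLinearGroup.map (starRingEnd ℂ) k.2), ?_⟩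
    have h := polyConj_matAct k.1.val k.2.val (hwPoly l)
    rw [hwPoly, polyConj_minorProd] at h
    exact h.symm
  | zero => simp
  | add x y _ _ hx hy => rw [map_add]; exact Submodule.add_mem _ hx hy
  | smul c x _ hx => rw [polyConj_smul]; exact Submodule.smul_mem _ _ hx

theorem polyPairing_of_mem_hwModule {l : PtnLe (min n p)} {y : MvPolynomial (Fin n × Fin p) ℂ}
    (hy : ∀ g, polyPairing (polyRep n p g y) (hwPoly l) = 0)
    {z : MvPolynomial (Fin n × Fin p) ℂ} (hz : z ∈ hwModule l) : polyPairing y z = 0 := by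
  refine (Submodule.span_le.2 ?_ : hwModule l ≤ LinearMap.ker (polyPairing y)) hz
  rintro _ ⟨⟨g, h⟩, rfl⟩
  have := polyPairing_polyRep (glTranspose g) (glTranspose h) y (hwPoly l)
  rw [glTranspose_glTranspose, glTranspose_glTranspose, hy] at this
  exact this.symm

theorem polyPairing_hwModule_of_ne {l l' : PtnLe (min n p)} (hl : l ≠ l')
    {x y : MvPolynomial (Fin n × Fin p) ℂ} (hx : x ∈ hwModule l) (hy : y ∈ hwModule l') :
    polyPairing x y = 0 := by
  refine polyPairing_of_mem_hwModule (fun g => ?_) hy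
  refine (Submodule.span_le.2 ?_ : hwModule l ≤
    LinearMap.ker (polyPairing.flip (hwPoly l'))) (polyRep_mem_hwModule hx g)
  rintro _ ⟨g, rfl⟩
  exact polyPairing_polyRep_hwPoly_of_ne hl g

theorem eq_zero_of_mem_hwModule {l : PtnLe (min n p)} {y : MvPolynomial (Fin n × Fin p) ℂ}
    (hy : y ∈ hwModule l) (h : ∀ z ∈ hwModule l, polyPairing y z = 0) : y = 0 :=
  eq_zero_of_polyPairing_conj y (h _ (polyConj_mem_hwModule hy))

theorem exists_embedding_hwModule (l : PtnLe (min n p)) {V W : Type*} [AddCommGroup V]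
    [Module ℂ V] [AddCommGroup W] [Module ℂ W] {ρ : Representation ℂ (GL (Fin n) ℂ) V}
    {τ : Representation ℂ (GL (Fin p) ℂ) W} (hρ : IsGLHW n (polyWeight n l.1) ρ)
    (hτ : IsGLHW p (polyWeight p l.1) τ) :
    ∃ f : V ⊗[ℂ] W →ₗ[ℂ] MvPolynomial (Fin n × Fin p) ℂ, Function.Injective f ∧
      (∀ g x, f (tensorRep ρ τ g x) = polyRep n p g (f x)) ∧ LinearMap.range f = hwModule l := by
  have := hρ.2.1
  have := hτ.2.1
  obtain ⟨v, α, -, hv0, hα0, hα⟩ := hρ.exists_coeff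
  obtain ⟨w, β, -, hw0, hβ0, hβ⟩ := hτ.exists_coeff
  have hc := polyPairing_hwPoly_self_ne_zero l
  refine exists_injective_of_coeff_eq (tensorRep ρ τ) (polyRep n p) (v ⊗ₜ w) (hwPoly l)
    (tensorDual α β)
    ((polyPairing (hwPoly l) (hwPoly l : MvPolynomial (Fin n × Fin p) ℂ))⁻¹ •
      polyPairing.flip (hwPoly l)) ?_ ?_ ?_ ?_
  · rintro ⟨g, h⟩
    refine eq_of_eq_on_bigCell_prod (φ := fun g h => α (ρ g v) * β (τ h w))
      (ψ := fun g h => ((polyPairing (hwPoly l) (hwPoly l : MvPolynomial (Fin n × Fin p) ℂ))⁻¹ •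
        polyPairing.flip (hwPoly l)) (polyRep n p (g, h) (hwPoly l)))
      (fun h => ?_) (fun g => isPathPolynomial_coeff τ (α (ρ g v) • β) w)
      (fun h => isPathPolynomial_polyRep_left _ _ h)
      (fun g => isPathPolynomial_polyRep_right _ _ g) ?_ g h
    · simpa [mul_comm] using isPathPolynomial_coeff ρ (β (τ h w) • α) v
    · rintro g h ⟨a, u, d, ha, hu, hd, e, he⟩ ⟨a', u', d', ha', hu', hd', e', he'⟩
      rw [hα a g u d ha hu hd e he, hβ a' h u' d' ha' hu' hd' e' he', LinearMap.smul_apply,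
        LinearMap.flip_apply,
        polyPairing_polyRep_hwPoly_of_bigCell l l ha hu hd ha' hu' hd' he he', smul_eq_mul]
      field_simp
  · exact span_orbit_tensorRep (hρ.1.span_orbit_eq_top hv0) (hτ.1.span_orbit_eq_top hw0)
  · exact eq_zero_of_tensorDual_eq_zero (fun x hx => hρ.1.eq_zero_of_coeff_eq_zero hα0 hx)
      fun x hx => hτ.1.eq_zero_of_coeff_eq_zero hβ0 hx
  · intro y hy h
    refine eq_zero_of_mem_hwModule hy fun z hz => polyPairing_of_mem_hwModule (fun g => ?_) hz
    exact (mul_eq_zero.1 (h g)).resolve_left (inv_ne_zero hc)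

theorem exists_highest_of_stable (C : Submodule ℂ (MvPolynomial (Fin n × Fin p) ℂ))
    [FiniteDimensional ℂ C] (hC : C ≠ ⊥) (hstab : IsSubrep (polyRep n p) C) :
    ∃ q ∈ C, q ≠ 0 ∧ ∀ (w : GL (Fin n) ℂ) (u : GL (Fin p) ℂ), IsUpperUni w.val →
      IsUpperUni u.val → matAct w.val u.val q = q := by
  have := (Submodule.nontrivial_iff_ne_bot).2 hC
  obtain ⟨v, hv0, hv⟩ := exists_isUpperUni_fixed (Representation.subrepresentation
    ((polyRep n p).comp (MonoidHom.inl _ _)) C fun g x hx => hstab _ x hx)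
  let C' : Submodule ℂ (MvPolynomial (Fin n × Fin p) ℂ) := C ⊓
    ⨅ w : {w : GL (Fin n) ℂ // IsUpperUni w.val}, LinearMap.ker (polyRep n p (w.1, 1) - 1)
  have hC' : ∀ q, q ∈ C' ↔ q ∈ C ∧ ∀ w : GL (Fin n) ℂ, IsUpperUni w.val →
      polyRep n p (w, 1) q = q := by
    intro q
    simp [C', Submodule.mem_iInf, sub_eq_zero]
  have : FiniteDimensional ℂ C' := Submodule.finiteDimensional_of_le inf_le_left
  have : Nontrivial C' := Submodule.nontrivial_iff_ne_bot.2 <| (Submodule.ne_bot_iff _).2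
    ⟨v, (hC' _).2 ⟨v.2, fun w hw => congrArg Subtype.val (hv w hw)⟩, by simpa using hv0⟩
  have hstab' : ∀ h : GL (Fin p) ℂ, C' ≤ C'.comap (((polyRep n p).comp (MonoidHom.inr _ _)) h) := by
    intro h x hx
    refine (hC' _).2 ⟨hstab _ x ((hC' x).1 hx).1, fun w hw => ?_⟩
    have hcomm : ((w, 1) * (1, h) : GL (Fin n) ℂ × GL (Fin p) ℂ) = (1, h) * (w, 1) := by simp
    change polyRep n p (w, 1) (polyRep n p (1, h) x) = polyRep n p (1, h) x
    rw [← Module.End.mul_apply, ← map_mul, hcomm, map_mul, Module.End.mul_apply,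
      ((hC' x).1 hx).2 w hw]
  obtain ⟨q, hq0, hq⟩ := exists_isUpperUni_fixed (Representation.subrepresentation _ C' hstab')
  refine ⟨q, ((hC' _).1 q.2).1, by simpa using hq0, fun w u hw hu => ?_⟩
  have h1 : polyRep n p (1, u) q = q := congrArg Subtype.val (hq u hu)
  have h2 := ((hC' _).1 q.2).2 w hw
  have h3 : polyRep n p (w, u) q = polyRep n p (w, 1) (polyRep n p (1, u) q) := by
    rw [← Module.End.mul_apply, ← map_mul]
    simp
  rw [h1, h2] at h3
  exact h3

theorem iSup_hwModule_eq_top : ⨆ l, hwModule (n := n) (p := p) l = ⊤ := by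
  set M := ⨆ l, hwModule (n := n) (p := p) l
  have hconj : ∀ x ∈ M, polyConj x ∈ M := by
    intro x hx
    induction hx using Submodule.iSup_induction' with
    | mem l x hx => exact Submodule.mem_iSup_of_mem l (polyConj_mem_hwModule hx)
    | zero => simp
    | add x y _ _ hx hy => rw [map_add]; exact Submodule.add_mem _ hx hy
  have hstab : ∀ g, ∀ x ∈ M, polyRep n p g x ∈ M := by
    intro g x hx
    induction hx using Submodule.iSup_induction' with
    | mem l x hx => exact Submodule.mem_iSup_of_mem l (polyRep_mem_hwModule hx g)
    | zero => simp
    | add x y _ _ hx hy => rw [map_add]; exact Submodule.add_mem _ hx hy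
  refine eq_top_iff.2 fun F _ => ?_
  by_contra hF
  let W := MvPolynomial.restrictTotalDegree (Fin n × Fin p) ℂ F.totalDegree
  have hW : ∀ x, x ∈ W ↔ x.totalDegree ≤ F.totalDegree :=
    MvPolynomial.mem_restrictTotalDegree _ _
  let B : W →ₗ[ℂ] Module.Dual ℂ W := (polyPairing.domRestrict₁₂ W W).flip
  have hB : Function.Injective B := by
    rw [← LinearMap.ker_eq_bot, LinearMap.ker_eq_bot']
    intro q hq
    have h1 := LinearMap.congr_fun hq ⟨polyConj q, (hW _).2
      ((totalDegree_polyConj_le _).trans ((hW _).1 q.2))⟩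
    refine Subtype.ext (eq_zero_of_polyPairing_conj q.1 ?_)
    rw [polyPairing_comm]
    exact h1
  have hBs : Function.Surjective B :=
    (LinearMap.injective_iff_surjective_of_finrank_eq_finrank
      Subspace.dual_finrank_eq.symm).1 hB
  let C : Submodule ℂ (MvPolynomial (Fin n × Fin p) ℂ) := W ⊓
    ⨅ x : {x // x ∈ M ⊓ W}, LinearMap.ker (polyPairing x.1)
  have hC : ∀ q, q ∈ C ↔ q ∈ W ∧ ∀ x ∈ M, x ∈ W → polyPairing x q = 0 := by
    intro q
    simp [C, Submodule.mem_iInf]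
  have hC0 : C ≠ ⊥ := by
    have hF' : (⟨F, (hW F).2 le_rfl⟩ : W) ∉ M.comap W.subtype := hF
    obtain ⟨φ, hφF, hφ⟩ := Submodule.exists_le_ker_of_notMem hF'
    obtain ⟨q, rfl⟩ := hBs φ
    refine (Submodule.ne_bot_iff _).2 ⟨q, (hC _).2 ⟨q.2, fun x hx hxW => ?_⟩, ?_⟩
    · exact hφ (x := ⟨x, hxW⟩) hx
    · intro h0
      have : q = 0 := Subtype.ext h0
      exact hφF (by rw [this, map_zero]; rfl)
  have : FiniteDimensional ℂ C := Submodule.finiteDimensional_of_le inf_le_left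
  obtain ⟨q, hqC, hq0, hq⟩ := exists_highest_of_stable C hC0 (by
    rintro ⟨g, h⟩ x hx
    refine (hC _).2 ⟨(hW _).2 ((totalDegree_matAct_le _ _ x).trans ((hW _).1 ((hC x).1 hx).1)),
      fun y hy hyW => ?_⟩
    have := polyPairing_polyRep (glTranspose g) (glTranspose h) y x
    rw [glTranspose_glTranspose, glTranspose_glTranspose] at this
    rw [← this]
    exact ((hC x).1 hx).2 _ (hstab _ y hy)
      ((hW _).2 ((totalDegree_matAct_le _ _ y).trans ((hW _).1 hyW))))
  have hqM : q ∈ M := by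
    refine Submodule.span_le.2 ?_ (mem_span_hwPoly hq)
    rintro _ ⟨l, rfl⟩
    exact Submodule.mem_iSup_of_mem l (hwPoly_mem_hwModule l)
  refine hq0 (eq_zero_of_polyPairing_conj q ?_)
  rw [polyPairing_comm]
  exact ((hC q).1 hqC).2 _ (hconj q hqM)
    ((hW _).2 ((totalDegree_polyConj_le q).trans ((hW _).1 ((hC q).1 hqC).1)))

end Duality

theorem toModule_mapRange_apply {R ι N : Type*} [CommRing R] [DecidableEq ι] {M : ι → Type*}
    [∀ i, AddCommGroup (M i)] [∀ i, Module R (M i)] [AddCommGroup N] [Module R N]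
    (f : ∀ i, M i →ₗ[R] M i) (ψ : ∀ i, M i →ₗ[R] N) (T : N →ₗ[R] N)
    (h : ∀ i x, ψ i (f i x) = T (ψ i x)) (y : ⨁ i, M i) :
    DirectSum.toModule R ι N ψ (DFinsupp.mapRange.linearMap f y) =
      T (DirectSum.toModule R ι N ψ y) := by
  induction y using DirectSum.induction_on with
  | zero => simp
  | of i x =>
    have h1 : DFinsupp.mapRange.linearMap f (DirectSum.lof R ι M i x) =
        DirectSum.lof R ι M i (f i x) := DFinsupp.mapRange_single (hf := fun l => map_zero _)
    rw [← DirectSum.lof_eq_of R, h1, DirectSum.toModule_lof, DirectSum.toModule_lof, h]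
  | add x y hx hy => simp only [map_add, hx, hy]

theorem toModule_bijective_of_range_eq_hwModule {n p : ℕ} [DecidableEq (PtnLe (min n p))]
    {M : PtnLe (min n p) → Type*} [∀ l, AddCommGroup (M l)] [∀ l, Module ℂ (M l)]
    (ψ : ∀ l, M l →ₗ[ℂ] MvPolynomial (Fin n × Fin p) ℂ) (hinj : ∀ l, Function.Injective (ψ l))
    (hrange : ∀ l, LinearMap.range (ψ l) = hwModule l) :
    Function.Bijective (DirectSum.toModule ℂ _ _ ψ) := by
  have hmem : ∀ l x, ψ l x ∈ hwModule l := fun l x => hrange l ▸ LinearMap.mem_range_self _ x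
  have hpair : ∀ m, ∀ z ∈ hwModule m, ∀ x : ⨁ l, M l,
      polyPairing (DirectSum.toModule ℂ _ _ ψ x) z = polyPairing (ψ m (x m)) z := by
    intro m z hz x
    induction x using DirectSum.induction_on with
    | zero => simp
    | of l x =>
      rw [← DirectSum.lof_eq_of ℂ, DirectSum.toModule_lof]
      rcases eq_or_ne l m with rfl | hl
      · rw [DirectSum.lof_apply]
      · rw [polyPairing_hwModule_of_ne hl (hmem l x) hz, DirectSum.lof_eq_of,
          DirectSum.of_eq_of_ne _ _ _ hl.symm, map_zero, map_zero, LinearMap.zero_apply]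
    | add x y hx hy => simp [hx, hy]
  constructor
  · refine (injective_iff_map_eq_zero _).2 fun x hx => DFinsupp.ext fun l => ?_
    refine (injective_iff_map_eq_zero (ψ l)).1 (hinj l) _
      (eq_zero_of_mem_hwModule (hmem l _) fun z hz => ?_)
    rw [← hpair l z hz x, hx, map_zero, LinearMap.zero_apply]
  · refine LinearMap.range_eq_top.1 (top_le_iff.1 (iSup_hwModule_eq_top.symm.le.trans
      (iSup_le fun l => ?_)))
    rw [← hrange l]
    rintro _ ⟨x, rfl⟩
    exact ⟨DirectSum.lof ℂ _ _ l x, DirectSum.toModule_lof ..⟩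

/-- `GL_n × GL_p` duality, equation (3.12).  The polynomial algebra
`P(ℂ^n ⊗ ℂ^p)` on `n × p` matrices, under the commuting left and right multiplication
actions of `GL_n(ℂ)` and `GL_p(ℂ)`, decomposes multiplicity-freely as
`P(ℂ^n ⊗ ℂ^p) = ⊕_λ F^λ_(n) ⊗ F^λ_(p)`, where `λ` runs over all partitions with
`ℓ(λ) ≤ min(n,p)`. -/
theorem GLn_GLp_duality (n p : ℕ)
    (ρ : Representation ℂ (GL (Fin n) ℂ × GL (Fin p) ℂ)
      (MvPolynomial (Fin n × Fin p) ℂ))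
    -- the action is by algebra automorphisms, induced by the two-sided matrix
    -- multiplication action of `GL_n × GL_p` on `ℂ^n ⊗ ℂ^p` (the variables
    -- `X (i, j)` span a copy of the `GL_n × GL_p`-representation `ℂ^n ⊗ ℂ^p`)
    (hone : ∀ gh : GL (Fin n) ℂ × GL (Fin p) ℂ, ρ gh 1 = 1)
    (hmul : ∀ (gh : GL (Fin n) ℂ × GL (Fin p) ℂ)
      (F F' : MvPolynomial (Fin n × Fin p) ℂ), ρ gh (F * F') = ρ gh F * ρ gh F')
    (hgen : ∀ (g : GL (Fin n) ℂ) (h : GL (Fin p) ℂ) (a : Fin n) (b : Fin p),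
      ρ (g, h) (MvPolynomial.X (a, b)) =
        ∑ i : Fin n, ∑ j : Fin p,
          ((↑g : Matrix (Fin n) (Fin n) ℂ) i a * (↑h : Matrix (Fin p) (Fin p) ℂ) j b) •
            MvPolynomial.X (i, j))
    -- the irreducible representations `F^λ_(n)` and `F^λ_(p)`
    (FN : PtnLe (min n p) → Type*) [∀ l, AddCommGroup (FN l)] [∀ l, Module ℂ (FN l)]
    (ρN : ∀ l, Representation ℂ (GL (Fin n) ℂ) (FN l))
    (hρN : ∀ l, IsGLHW n (polyWeight n l.1) (ρN l))
    (FP : PtnLe (min n p) → Type*) [∀ l, AddCommGroup (FP l)] [∀ l, Module ℂ (FP l)]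
    (ρP : ∀ l, Representation ℂ (GL (Fin p) ℂ) (FP l))
    (hρP : ∀ l, IsGLHW p (polyWeight p l.1) (ρP l)) :
    ∃ e : MvPolynomial (Fin n × Fin p) ℂ ≃ₗ[ℂ] ⨁ l : PtnLe (min n p), (FN l ⊗[ℂ] FP l),
      ∀ (g : GL (Fin n) ℂ) (h : GL (Fin p) ℂ),
        (e : MvPolynomial (Fin n × Fin p) ℂ →ₗ[ℂ]
            ⨁ l : PtnLe (min n p), (FN l ⊗[ℂ] FP l)) ∘ₗ (ρ (g, h)) =
        (DFinsupp.mapRange.linearMap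
          fun l => TensorProduct.map (ρN l g) (ρP l h)) ∘ₗ
          (e : MvPolynomial (Fin n × Fin p) ℂ →ₗ[ℂ]
            ⨁ l : PtnLe (min n p), (FN l ⊗[ℂ] FP l)) := by
  classical
  have hρ : ∀ g h F, ρ (g, h) F = polyRep n p (g, h) F := by
    intro g h F
    induction F using MvPolynomial.induction_on with
    | C a => rw [← mul_one (MvPolynomial.C a), ← MvPolynomial.smul_eq_C_mul, map_smul, map_smul,
        hone, polyRep_apply, map_one]
    | add F F' hF hF' => rw [map_add, map_add, hF, hF']
    | mul_X F x hF => rw [hmul, hF, hgen, polyRep_apply, polyRep_apply, map_mul, matAct_X]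
  choose ψ hinj hequiv hrange using fun l => exists_embedding_hwModule l (hρN l) (hρP l)
  let E := LinearEquiv.ofBijective _ (toModule_bijective_of_range_eq_hwModule ψ hinj hrange)
  refine ⟨E.symm, fun g h => LinearMap.ext fun F => ?_⟩
  obtain ⟨y, rfl⟩ := E.surjective F
  simp only [LinearMap.comp_apply, LinearEquiv.coe_coe, LinearEquiv.symm_apply_apply]
  rw [LinearEquiv.symm_apply_eq, hρ]
  exact (toModule_mapRange_apply _ ψ (polyRep n p (g, h))
    (fun l x => hequiv l (g, h) x) y).symm

end
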